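/- arXiv:1510.00430 — 4 statements merged into one kernel-verified Lean document; each statement's English description precedes it below -/
import Mathlib

section
/- Let η = (c0,c1,c2,c3) be a symmetric 3-differential holomorphic on an open set U ⊆ ℂ × ℂ, and let x ∈ U be a point at which η is non-degenerate. Then there exist an open neighborhood V ⊆ U of x and holomorphic 1-forms ω1, ω2, ω3 on V such that ω1 + ω2 + ω3 = 0, the wedge product ωi ∧ ωj is nonvanishing on V for all i ≠ j, and the symmetric product ω1·ω2·ω3 equals η on V. -/
noncomputable section

/-- Partial derivative in the first (`z`) variable. -/
def pz (F : ℂ × ℂ → ℂ) (p : ℂ × ℂ) : ℂ := fderiv ℂ F p (1, 0)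

/-- Partial derivative in the second (`w`) variable. -/
def pw (F : ℂ × ℂ → ℂ) (p : ℂ × ℂ) : ℂ := fderiv ℂ F p (0, 1)

/-- A 1-form `P dz + Q dw` given by its pair of coefficient functions. -/
abbrev Form1 := (ℂ × ℂ → ℂ) × (ℂ × ℂ → ℂ)

/-- A 1-form is holomorphic on `U` if both coefficients are. -/
def HoloForm (ω : Form1) (U : Set (ℂ × ℂ)) : Prop :=
  DifferentiableOn ℂ ω.1 U ∧ DifferentiableOn ℂ ω.2 U

/-- Wedge product of two 1-forms (coefficient of `dz ∧ dw`). -/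
def wedge (ω ω' : Form1) (p : ℂ × ℂ) : ℂ := ω.1 p * ω'.2 p - ω.2 p * ω'.1 p

/-- Exterior derivative `Q_z - P_w` of `P dz + Q dw` (coefficient of `dz ∧ dw`). -/
def dForm (ω : Form1) (p : ℂ × ℂ) : ℂ := pz ω.2 p - pw ω.1 p

/-- A 1-form `P dz + Q dw` is closed on `V` if `P_w = Q_z` there. -/
def IsClosed1 (ω : Form1) (V : Set (ℂ × ℂ)) : Prop := ∀ p ∈ V, pw ω.1 p = pz ω.2 p

/-- The differential of a function, as a 1-form. -/
def dfun (φ : ℂ × ℂ → ℂ) : Form1 := (pz φ, pw φ)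

def addF (ω ω' : Form1) : Form1 := (fun p => ω.1 p + ω'.1 p, fun p => ω.2 p + ω'.2 p)
def subF (ω ω' : Form1) : Form1 := (fun p => ω.1 p - ω'.1 p, fun p => ω.2 p - ω'.2 p)
def fsmul (h : ℂ × ℂ → ℂ) (ω : Form1) : Form1 :=
  (fun p => h p * ω.1 p, fun p => h p * ω.2 p)
def csmul (c : ℂ) (ω : Form1) : Form1 := (fun p => c * ω.1 p, fun p => c * ω.2 p)

/-- Coefficients of the symmetric product of three 1-forms. -/
def symC0 (a b c : Form1) (p : ℂ × ℂ) : ℂ := a.1 p * b.1 p * c.1 p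
def symC1 (a b c : Form1) (p : ℂ × ℂ) : ℂ :=
  a.1 p * b.1 p * c.2 p + a.1 p * b.2 p * c.1 p + a.2 p * b.1 p * c.1 p
def symC2 (a b c : Form1) (p : ℂ × ℂ) : ℂ :=
  a.1 p * b.2 p * c.2 p + a.2 p * b.1 p * c.2 p + a.2 p * b.2 p * c.1 p
def symC3 (a b c : Form1) (p : ℂ × ℂ) : ℂ := a.2 p * b.2 p * c.2 p

/-- The symmetric 3-differential `c0 dz³ + c1 dz²dw + c2 dz dw² + c3 dw³` is
non-degenerate at `x` if the binary cubic `c0 s³ + c1 s²t + c2 st² + c3 t³` is nonzero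
and has three pairwise non-proportional roots in the projective line. -/
def NonDegAt (c0 c1 c2 c3 : ℂ × ℂ → ℂ) (x : ℂ × ℂ) : Prop :=
  (c0 x ≠ 0 ∨ c1 x ≠ 0 ∨ c2 x ≠ 0 ∨ c3 x ≠ 0) ∧
  ∃ r : Fin 3 → ℂ × ℂ,
    (∀ i j, i ≠ j → (r i).1 * (r j).2 - (r i).2 * (r j).1 ≠ 0) ∧
    (∀ i, c0 x * (r i).1 ^ 3 + c1 x * (r i).1 ^ 2 * (r i).2 +
          c2 x * (r i).1 * (r i).2 ^ 2 + c3 x * (r i).2 ^ 3 = 0)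

/-- A symmetric 3-differential is closed at `x` if on some open neighborhood of `x`
(inside `U`) it is a symmetric product of three closed holomorphic 1-forms. -/
def ClosedAt (U : Set (ℂ × ℂ)) (c0 c1 c2 c3 : ℂ × ℂ → ℂ) (x : ℂ × ℂ) : Prop :=
  ∃ V : Set (ℂ × ℂ), IsOpen V ∧ x ∈ V ∧ V ⊆ U ∧
    ∃ z1 z2 z3 : Form1,
      HoloForm z1 V ∧ HoloForm z2 V ∧ HoloForm z3 V ∧
      IsClosed1 z1 V ∧ IsClosed1 z2 V ∧ IsClosed1 z3 V ∧
      ∀ p ∈ V, c0 p = symC0 z1 z2 z3 p ∧ c1 p = symC1 z1 z2 z3 p ∧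
               c2 p = symC2 z1 z2 z3 p ∧ c3 p = symC3 z1 z2 z3 p

/-- `D1 × D2` is an open polydisc. -/
def IsPolydisc (D1 D2 : Set ℂ) : Prop :=
  ∃ z0 w0 : ℂ, ∃ r1 r2 : ℝ, 0 < r1 ∧ 0 < r2 ∧
    D1 = Metric.ball z0 r1 ∧ D2 = Metric.ball w0 r2

/-- `A = ∂_z(a_w/a)`. -/
def Afun (a : ℂ × ℂ → ℂ) : ℂ × ℂ → ℂ := pz (fun p => pw a p / a p)

/-- `B = ∂_w(b_z/b)`. -/
def Bfun (b : ℂ × ℂ → ℂ) : ℂ × ℂ → ℂ := pw (fun p => pz b p / b p)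

/-- `ξ = (1/(A−B))·[ a·∂_z((b/a)·B) − b·∂_w((a/b)·A) ]`. -/
def xifun (a b : ℂ × ℂ → ℂ) : ℂ × ℂ → ℂ := fun p =>
  (Afun a p - Bfun b p)⁻¹ *
    (a p * pz (fun q => b q / a q * Bfun b q) p -
     b p * pw (fun q => a q / b q * Afun a q) p)

/-- A nonzero binary cubic with three pairwise non-proportional zeros is a product of three linear
forms with sum zero, the first two of which are linearly independent. -/
lemma exists_linear_factors_of_cubic {c0 c1 c2 c3 r1 r2 s1 s2 t1 t2 : ℂ}
    (hc : c0 ≠ 0 ∨ c1 ≠ 0 ∨ c2 ≠ 0 ∨ c3 ≠ 0)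
    (hrs : r1 * s2 - r2 * s1 ≠ 0) (hts : t1 * s2 - t2 * s1 ≠ 0) (hrt : r1 * t2 - r2 * t1 ≠ 0)
    (hr : c0 * r1 ^ 3 + c1 * r1 ^ 2 * r2 + c2 * r1 * r2 ^ 2 + c3 * r2 ^ 3 = 0)
    (hs : c0 * s1 ^ 3 + c1 * s1 ^ 2 * s2 + c2 * s1 * s2 ^ 2 + c3 * s2 ^ 3 = 0)
    (ht : c0 * t1 ^ 3 + c1 * t1 ^ 2 * t2 + c2 * t1 * t2 ^ 2 + c3 * t2 ^ 3 = 0) :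
    ∃ p q u v : ℂ, p * v - q * u ≠ 0 ∧
      c0 = -(p * u * (p + u)) ∧
      c1 = -(p * u * (q + v) + (p * v + q * u) * (p + u)) ∧
      c2 = -(q * v * (p + u) + (p * v + q * u) * (q + v)) ∧
      c3 = -(q * v * (q + v)) := by
  -- `c` and `d` are the mixed coefficients of the cubic in the basis `r`, `s`.
  obtain ⟨c, hcdef⟩ : ∃ c, c = 3 * c0 * r1 ^ 2 * s1 + c1 * (r1 ^ 2 * s2 + 2 * r1 * r2 * s1) +
    c2 * (2 * r1 * r2 * s2 + r2 ^ 2 * s1) + 3 * c3 * r2 ^ 2 * s2 := ⟨_, rfl⟩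
  obtain ⟨d, hddef⟩ : ∃ d, d = 3 * c0 * s1 ^ 2 * r1 + c1 * (s1 ^ 2 * r2 + 2 * s1 * s2 * r1) +
    c2 * (2 * s1 * s2 * r2 + s2 ^ 2 * r1) + 3 * c3 * s2 ^ 2 * r2 := ⟨_, rfl⟩
  obtain ⟨D, hD⟩ : ∃ D, D = r1 * s2 - r2 * s1 := ⟨_, rfl⟩
  obtain ⟨a, ha⟩ : ∃ a, a = t1 * s2 - t2 * s1 := ⟨_, rfl⟩
  obtain ⟨b, hb⟩ : ∃ b, b = r1 * t2 - r2 * t1 := ⟨_, rfl⟩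
  rw [← hD] at hrs
  rw [← ha] at hts
  rw [← hb] at hrt
  have e0 : D ^ 3 * c0 = -(s2 ^ 2 * r2 * c) + s2 * r2 ^ 2 * d := by
    subst hcdef hddef hD
    linear_combination s2 ^ 3 * hr - r2 ^ 3 * hs
  have e1 : D ^ 3 * c1 = (s2 ^ 2 * r1 + 2 * s1 * s2 * r2) * c
      - (s1 * r2 ^ 2 + 2 * s2 * r1 * r2) * d := by
    subst hcdef hddef hD
    linear_combination -3 * s2 ^ 2 * s1 * hr + 3 * r2 ^ 2 * r1 * hs
  have e2 : D ^ 3 * c2 = -((s1 ^ 2 * r2 + 2 * s1 * s2 * r1) * c)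
      + (s2 * r1 ^ 2 + 2 * s1 * r1 * r2) * d := by
    subst hcdef hddef hD
    linear_combination 3 * s2 * s1 ^ 2 * hr - 3 * r2 * r1 ^ 2 * hs
  have e3 : D ^ 3 * c3 = s1 ^ 2 * r1 * c - s1 * r1 ^ 2 * d := by
    subst hcdef hddef hD
    linear_combination -s1 ^ 3 * hr + r1 ^ 3 * hs
  have hcd : c * a + d * b = 0 := by
    have : a * b * (c * a + d * b) = 0 := by
      subst ha hb
      linear_combination D ^ 3 * ht - t1 ^ 3 * e0 - t1 ^ 2 * t2 * e1 - t1 * t2 ^ 2 * e2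
        - t2 ^ 3 * e3
    simpa [hts, hrt] using this
  obtain ⟨e, rfl⟩ : ∃ e, c = b * e := ⟨c / b, by field_simp⟩
  have hde : d = -(a * e) := mul_left_cancel₀ hrt (by linear_combination hcd)
  have hD3 : D ^ 3 ≠ 0 := pow_ne_zero 3 hrs
  have he : e ≠ 0 := by
    rintro rfl
    simp only [hde, mul_zero, neg_zero, add_zero, sub_zero, mul_eq_zero, hD3, false_or]
      at e0 e1 e2 e3
    simp [e0, e1, e2, e3] at hc
  obtain ⟨m, hm⟩ := IsAlgClosed.exists_pow_nat_eq (e / (a * b * D ^ 3)) (n := 3) (by norm_num)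
  have hm0 : m ≠ 0 := by
    rintro rfl
    have : e / (a * b * D ^ 3) ≠ 0 := by positivity
    exact this (by rw [← hm]; norm_num)
  have hm' : e = D ^ 3 * (m ^ 3 * a * b) := by
    rw [hm]
    field_simp
  refine ⟨m * b * s2, -(m * b * s1), m * a * r2, -(m * a * r1), ?_, ?_, ?_, ?_, ?_⟩
  · have : m * b * s2 * -(m * a * r1) - -(m * b * s1) * (m * a * r2) = -(m ^ 2 * a * b * D) := by
      rw [hD]
      ring
    rw [this]
    simp [hm0, hts, hrt, hrs]
  all_goals
    apply mul_left_cancel₀ hD3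
  · rw [e0, hde, hm']
    ring
  · rw [e1, hde, hm']
    ring
  · rw [e2, hde, hm']
    ring
  · rw [e3, hde, hm']
    ring

/-- The coefficients of the cubic `ω₁ ω₂ (-ω₁ - ω₂)` in terms of those of the linear forms
`ω₁`, `ω₂`. -/
def cubicOfForms (y : (ℂ × ℂ) × (ℂ × ℂ)) : (ℂ × ℂ) × (ℂ × ℂ) :=
  ((-(y.1.1 * y.2.1 * (y.1.1 + y.2.1)),
    -(y.1.1 * y.2.1 * (y.1.2 + y.2.2) + (y.1.1 * y.2.2 + y.1.2 * y.2.1) * (y.1.1 + y.2.1))),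
   (-(y.1.2 * y.2.2 * (y.1.1 + y.2.1) + (y.1.1 * y.2.2 + y.1.2 * y.2.1) * (y.1.2 + y.2.2)),
    -(y.1.2 * y.2.2 * (y.1.2 + y.2.2))))

lemma contDiff_cubicOfForms {n : WithTop ℕ∞} : ContDiff ℂ n cubicOfForms := by
  unfold cubicOfForms
  fun_prop

lemma fderiv_cubicOfForms_injective {y : (ℂ × ℂ) × (ℂ × ℂ)}
    (hy : y.1.1 * y.2.2 - y.1.2 * y.2.1 ≠ 0) :
    Function.Injective (fderiv ℂ cubicOfForms y) := by
  have h11 : HasFDerivAt (fun y : (ℂ × ℂ) × (ℂ × ℂ) => y.1.1) _ y :=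
    (hasFDerivAt_fst (𝕜 := ℂ) (p := y)).fst
  have h12 : HasFDerivAt (fun y : (ℂ × ℂ) × (ℂ × ℂ) => y.1.2) _ y :=
    (hasFDerivAt_fst (𝕜 := ℂ) (p := y)).snd
  have h21 : HasFDerivAt (fun y : (ℂ × ℂ) × (ℂ × ℂ) => y.2.1) _ y :=
    (hasFDerivAt_snd (𝕜 := ℂ) (p := y)).fst
  have h22 : HasFDerivAt (fun y : (ℂ × ℂ) × (ℂ × ℂ) => y.2.2) _ y :=
    (hasFDerivAt_snd (𝕜 := ℂ) (p := y)).snd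
  have hM := (h11.mul h22).add (h12.mul h21)
  have hd : HasFDerivAt cubicOfForms _ y :=
    ((((h11.mul h21).mul (h11.add h21)).neg.prodMk
      (((h11.mul h21).mul (h12.add h22)).add (hM.mul (h11.add h21))).neg).prodMk
    ((((h12.mul h22).mul (h11.add h21)).add (hM.mul (h12.add h22))).neg.prodMk
      ((h12.mul h22).mul (h12.add h22)).neg))
  rw [hd.fderiv, injective_iff_map_eq_zero]
  rintro ⟨⟨a1, a2⟩, ⟨b1, b2⟩⟩ h
  obtain ⟨⟨p, q⟩, ⟨u, v⟩⟩ := y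
  simp only [Prod.mk_eq_zero] at hy h ⊢
  simp at h
  obtain ⟨⟨h0, h1⟩, h2, h3⟩ := h
  have hW : (p * v - q * u) ^ 2 ≠ 0 := pow_ne_zero 2 hy
  have ha : a1 * q - a2 * p = 0 := mul_left_cancel₀ hW <| by
    linear_combination -q ^ 3 * h0 + q ^ 2 * p * h1 - q * p ^ 2 * h2 + p ^ 3 * h3
  have hb : b1 * v - b2 * u = 0 := mul_left_cancel₀ hW <| by
    linear_combination -v ^ 3 * h0 + v ^ 2 * u * h1 - v * u ^ 2 * h2 + u ^ 3 * h3
  have hab : (a1 + b1) * (q + v) - (a2 + b2) * (p + u) = 0 := mul_left_cancel₀ hW <| by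
    linear_combination (q + v) ^ 3 * h0 - (q + v) ^ 2 * (p + u) * h1
      + (q + v) * (p + u) ^ 2 * h2 - (p + u) ^ 3 * h3
  have hab' : (a1 + b1) * (q - v) - (a2 + b2) * (p - u) = 0 := mul_left_cancel₀ hW <| by
    linear_combination -1 / 3 * ((q - v) ^ 3 * h0 - (q - v) ^ 2 * (p - u) * h1
      + (q - v) * (p - u) ^ 2 * h2 - (p - u) ^ 3 * h3)
  have hA : a1 * v - a2 * u = 0 := by
    linear_combination (hab - hab') / 2 - hb
  have hB : b1 * q - b2 * p = 0 := by
    linear_combination (hab + hab') / 2 - ha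
  refine ⟨⟨?_, ?_⟩, ?_, ?_⟩ <;> apply mul_left_cancel₀ hy
  · linear_combination p * hA - u * ha
  · linear_combination q * hA - v * ha
  · linear_combination p * hb - u * hB
  · linear_combination q * hb - v * hB

/-- Near a product of three linear forms as above, the factorization can be chosen holomorphically
in the coefficients of the cubic. -/
lemma exists_local_section_cubicOfForms {y : (ℂ × ℂ) × (ℂ × ℂ)}
    (hy : y.1.1 * y.2.2 - y.1.2 * y.2.1 ≠ 0) :
    ∃ g : (ℂ × ℂ) × (ℂ × ℂ) → (ℂ × ℂ) × (ℂ × ℂ), g (cubicOfForms y) = y ∧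
      ∀ᶠ c in nhds (cubicOfForms y), DifferentiableAt ℂ g c ∧ cubicOfForms (g c) = c := by
  have hf : ContDiffAt ℂ 1 cubicOfForms y := contDiff_cubicOfForms.contDiffAt
  let e : ((ℂ × ℂ) × (ℂ × ℂ)) ≃L[ℂ] ((ℂ × ℂ) × (ℂ × ℂ)) :=
    (LinearEquiv.ofInjectiveEndo (fderiv ℂ cubicOfForms y).toLinearMap
      (fderiv_cubicOfForms_injective hy)).toContinuousLinearEquiv
  have he : HasFDerivAt cubicOfForms
      (e : ((ℂ × ℂ) × (ℂ × ℂ)) →L[ℂ] ((ℂ × ℂ) × (ℂ × ℂ))) y :=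
    (hf.differentiableAt one_ne_zero).hasFDerivAt
  refine ⟨hf.localInverse he one_ne_zero, hf.localInverse_apply_image he one_ne_zero, ?_⟩
  filter_upwards [(hf.to_localInverse he one_ne_zero).eventually (by simp),
    (hf.hasStrictFDerivAt' he one_ne_zero).eventually_right_inverse] with c h1 h2
  exact ⟨h1.differentiableAt one_ne_zero, h2⟩

/-- a non-degenerate symmetric 3-differential locally factors as a
symmetric product of three holomorphic 1-forms summing to zero, with pairwise
nonvanishing wedge products. -/
theorem stmt_0 (U : Set (ℂ × ℂ)) (hU : IsOpen U)
    (c0 c1 c2 c3 : ℂ × ℂ → ℂ)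
    (hc0 : DifferentiableOn ℂ c0 U) (hc1 : DifferentiableOn ℂ c1 U)
    (hc2 : DifferentiableOn ℂ c2 U) (hc3 : DifferentiableOn ℂ c3 U)
    (x : ℂ × ℂ) (hx : x ∈ U) (hnd : NonDegAt c0 c1 c2 c3 x) :
    ∃ V : Set (ℂ × ℂ), IsOpen V ∧ x ∈ V ∧ V ⊆ U ∧
      ∃ ω1 ω2 ω3 : Form1,
        HoloForm ω1 V ∧ HoloForm ω2 V ∧ HoloForm ω3 V ∧
        (∀ p ∈ V, ω1.1 p + ω2.1 p + ω3.1 p = 0 ∧ ω1.2 p + ω2.2 p + ω3.2 p = 0) ∧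
        (∀ p ∈ V, wedge ω1 ω2 p ≠ 0 ∧ wedge ω2 ω3 p ≠ 0 ∧ wedge ω3 ω1 p ≠ 0) ∧
        (∀ p ∈ V, c0 p = symC0 ω1 ω2 ω3 p ∧ c1 p = symC1 ω1 ω2 ω3 p ∧
                  c2 p = symC2 ω1 ω2 ω3 p ∧ c3 p = symC3 ω1 ω2 ω3 p) := by
  obtain ⟨hc, r, hr, hroot⟩ := hnd
  obtain ⟨p, q, u, v, hW, e0, e1, e2, e3⟩ := exists_linear_factors_of_cubic hc
    (hr 0 1 (by decide)) (hr 2 1 (by decide)) (hr 0 2 (by decide)) (hroot 0) (hroot 1) (hroot 2)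
  obtain ⟨g, hgy, hg⟩ := exists_local_section_cubicOfForms (y := ((p, q), (u, v))) hW
  let C : ℂ × ℂ → (ℂ × ℂ) × (ℂ × ℂ) := fun a => ((c0 a, c1 a), (c2 a, c3 a))
  have hC : DifferentiableOn ℂ C U := (hc0.prodMk hc1).prodMk (hc2.prodMk hc3)
  have hCx : C x = cubicOfForms ((p, q), (u, v)) := by
    simp only [C, cubicOfForms, e0, e1, e2, e3]
  rw [← hCx] at hgy hg
  have hUx : U ∈ nhds x := hU.mem_nhds hx
  have hCc : ContinuousAt C x := (hC.differentiableAt hUx).continuousAt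
  have hgc : ContinuousAt (g ∘ C) x :=
    ContinuousAt.comp (g := g) hg.self_of_nhds.1.continuousAt hCc
  have hwedge : ∀ᶠ a in nhds x,
      (g (C a)).1.1 * (g (C a)).2.2 - (g (C a)).1.2 * (g (C a)).2.1 ≠ 0 := by
    have : ContinuousAt (fun a => ((g ∘ C) a).1.1 * ((g ∘ C) a).2.2 -
        ((g ∘ C) a).1.2 * ((g ∘ C) a).2.1) x :=
      (hgc.fst.fst.mul hgc.snd.snd).sub (hgc.fst.snd.mul hgc.snd.fst)
    refine this.eventually_ne ?_
    simpa [hgy] using hW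
  obtain ⟨V, hV, hVo, hxV⟩ := eventually_nhds_iff.1
    (((hCc.eventually hg).and hwedge).and hUx)
  have hG : DifferentiableOn ℂ (fun a => g (C a)) V := fun a ha =>
    ((hV a ha).1.1.1.comp a (hC.differentiableAt (hU.mem_nhds (hV a ha).2))).differentiableWithinAt
  refine ⟨V, hVo, hxV, fun a ha => (hV a ha).2,
    (fun a => (g (C a)).1.1, fun a => (g (C a)).1.2),
    (fun a => (g (C a)).2.1, fun a => (g (C a)).2.2),
    (fun a => -((g (C a)).1.1 + (g (C a)).2.1), fun a => -((g (C a)).1.2 + (g (C a)).2.2)),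
    ⟨hG.fst.fst, hG.fst.snd⟩, ⟨hG.snd.fst, hG.snd.snd⟩,
    ⟨(hG.fst.fst.add hG.snd.fst).neg, (hG.fst.snd.add hG.snd.snd).neg⟩,
    fun a _ => ⟨by ring, by ring⟩, fun a ha => ?_, fun a ha => ?_⟩
  · have h := (hV a ha).1.2
    refine ⟨h, ?_, ?_⟩ <;> simp only [wedge] <;> convert! h using 1 <;> ring
  · have h := (hV a ha).1.1.2
    simp only [cubicOfForms, C, Prod.mk.injEq] at h
    obtain ⟨⟨h0, h1⟩, h2, h3⟩ := h
    simp only [symC0, symC1, symC2, symC3]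
    refine ⟨?_, ?_, ?_, ?_⟩
    · linear_combination -h0
    · linear_combination -h1
    · linear_combination -h2
    · linear_combination -h3
end
end

section
/- Let V ⊆ ℂ × ℂ be a connected open set and let (ω1, ω2, ω3) and (ω'1, ω'2, ω'3) be two triples of holomorphic 1-forms on V, each with pairwise nonvanishing wedge products, each satisfying ω1 + ω2 + ω3 = 0 and ω'1 + ω'2 + ω'3 = 0, and having equal symmetric products ω1·ω2·ω3 = ω'1·ω'2·ω'3 as symmetric 3-differentials on V. Then there exist a permutation σ of {1,2,3} and a complex number ζ with ζ³ = 1 such that ω'_i = ζ·ω_{σ(i)} on V for i = 1, 2, 3. -/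
noncomputable section

/-- A preconnected nonempty space that is a finite disjoint union of closed sets is one of them. -/
theorem exists_eq_univ_of_finite_closed_partition {X ι : Type*} [TopologicalSpace X]
    [PreconnectedSpace X] [Nonempty X] [Finite ι] (C : ι → Set X) (hC : ∀ i, IsClosed (C i))
    (hdisj : ∀ i j x, x ∈ C i → x ∈ C j → i = j) (hcover : ∀ x, ∃ i, x ∈ C i) :
    ∃ i, C i = Set.univ := by
  obtain ⟨x⟩ := ‹Nonempty X›
  obtain ⟨i, hi⟩ := hcover x
  refine ⟨i, IsClopen.eq_univ ⟨hC i, ?_⟩ ⟨x, hi⟩⟩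
  have hcompl : (C i)ᶜ = ⋃ j : {j // j ≠ i}, C j := by
    ext y
    simp only [Set.mem_compl_iff, Set.mem_iUnion, Subtype.exists, exists_prop]
    constructor
    · intro hy
      obtain ⟨j, hj⟩ := hcover y
      exact ⟨j, fun h => hy (h ▸ hj), hj⟩
    · rintro ⟨j, hne, hj⟩ hy
      exact hne (hdisj j i y hj hy)
  rw [← isClosed_compl_iff, hcompl]
  exact isClosed_iUnion_of_finite fun j => hC j

/-- If a nonzero vector of `ℂ²` has zero determinant with another one, the latter is a
multiple of it. -/
theorem exists_smul_of_det_eq_zero {a b c d : ℂ} (hne : a ≠ 0 ∨ b ≠ 0) (h : a * d - b * c = 0) :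
    ∃ k : ℂ, c = k * a ∧ d = k * b := by
  rcases hne with ha | hb
  · refine ⟨c / a, by field_simp, ?_⟩
    field_simp
    linear_combination h
  · refine ⟨d / b, ?_, by field_simp⟩
    field_simp
    linear_combination -h

/-- Two factorizations of a binary cubic into pairwise independent linear forms of zero sum
agree up to a permutation and a cube root of unity. -/
theorem linear_factors_unique (P Q P' Q' : Fin 3 → ℂ)
    (hw : ∀ i j, i ≠ j → P i * Q j - Q i * P j ≠ 0)
    (hw' : ∀ i j, i ≠ j → P' i * Q' j - Q' i * P' j ≠ 0)
    (hP : ∑ i, P i = 0) (hQ : ∑ i, Q i = 0) (hP' : ∑ i, P' i = 0) (hQ' : ∑ i, Q' i = 0)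
    (hprod : ∀ s t : ℂ, ∏ i, (P i * s + Q i * t) = ∏ i, (P' i * s + Q' i * t)) :
    ∃ σ : Equiv.Perm (Fin 3), ∃ ζ : ℂ, ζ ^ 3 = 1 ∧
      ∀ i, P' i = ζ * P (σ i) ∧ Q' i = ζ * Q (σ i) := by
  have hmatch : ∀ i, ∃ j, P j * Q' i - Q j * P' i = 0 := by
    intro i
    have h := hprod (Q' i) (-P' i)
    rw [Finset.prod_eq_zero (f := fun j => P' j * Q' i + Q' j * -P' i) (Finset.mem_univ i)
      (by ring), Finset.prod_eq_zero_iff] at h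
    obtain ⟨j, -, hj⟩ := h
    exact ⟨j, by linear_combination hj⟩
  choose f hf using hmatch
  have hne : ∀ j, P j ≠ 0 ∨ Q j ≠ 0 := by
    intro j
    by_contra! h
    exact hw j (j + 1) (by fin_cases j <;> decide) (by simp [h.1, h.2])
  choose c hcP hcQ using fun i => exists_smul_of_det_eq_zero (hne (f i)) (hf i)
  have hinj : Function.Injective f := by
    intro i j hij
    by_contra hne
    apply hw' i j hne
    rw [hcP i, hcQ i, hcP j, hcQ j, hij]
    ring
  let σ : Equiv.Perm (Fin 3) := Equiv.ofBijective f (Finite.injective_iff_bijective.mp hinj)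
  have hRsum : ∑ i, P (f i) = 0 := (Equiv.sum_comp σ P).trans hP
  have hSsum : ∑ i, Q (f i) = 0 := (Equiv.sum_comp σ Q).trans hQ
  have hdet : P (f 0) * Q (f 1) - Q (f 0) * P (f 1) ≠ 0 :=
    hw _ _ (hinj.ne (by decide))
  simp only [Fin.sum_univ_three] at hRsum hSsum hP' hQ'
  rw [hcP 0, hcP 1, hcP 2] at hP'
  rw [hcQ 0, hcQ 1, hcQ 2] at hQ'
  have h02 : c 0 = c 2 := by
    refine sub_eq_zero.mp ((mul_eq_zero.mp ?_).resolve_right hdet)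
    linear_combination Q (f 1) * hP' - P (f 1) * hQ' - c 2 * Q (f 1) * hRsum +
      c 2 * P (f 1) * hSsum
  have h12 : c 1 = c 2 := by
    refine sub_eq_zero.mp ((mul_eq_zero.mp ?_).resolve_right hdet)
    linear_combination P (f 0) * hQ' - Q (f 0) * hP' - c 2 * P (f 0) * hSsum +
      c 2 * Q (f 0) * hRsum
  refine ⟨σ, c 2, ?_, ?_⟩
  · have h := hprod (Q (f 0) - Q (f 1)) (-(P (f 0) - P (f 1)))
    rw [← Equiv.prod_comp σ] at h
    simp only [Fin.prod_univ_three, σ, Equiv.ofBijective_apply] at h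
    rw [hcP 0, hcP 1, hcP 2, hcQ 0, hcQ 1, hcQ 2, h02, h12,
      show P (f 2) = -P (f 0) - P (f 1) by linear_combination hRsum,
      show Q (f 2) = -Q (f 0) - Q (f 1) by linear_combination hSsum] at h
    have hD : 2 * (P (f 0) * Q (f 1) - Q (f 0) * P (f 1)) ^ 3 ≠ 0 :=
      mul_ne_zero two_ne_zero (pow_ne_zero 3 hdet)
    refine sub_eq_zero.mp ((mul_eq_zero.mp ?_).resolve_right hD)
    linear_combination -h
  · intro i
    have hi : c i = c 2 := by
      fin_cases i
      · exact h02
      · exact h12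
      · rfl
    exact ⟨hi ▸ hcP i, hi ▸ hcQ i⟩

/-- the normalized decomposition `ω1 + ω2 + ω3 = 0` of a symmetric
3-differential is unique up to a permutation and a cube root of unity. -/
theorem stmt_1 (V : Set (ℂ × ℂ)) (hV : IsOpen V) (hconn : IsConnected V)
    (ω ω' : Fin 3 → Form1)
    (hholo : ∀ i, HoloForm (ω i) V) (hholo' : ∀ i, HoloForm (ω' i) V)
    (hwedge : ∀ i j, i ≠ j → ∀ p ∈ V, wedge (ω i) (ω j) p ≠ 0)
    (hwedge' : ∀ i j, i ≠ j → ∀ p ∈ V, wedge (ω' i) (ω' j) p ≠ 0)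
    (hsum : ∀ p ∈ V, (ω 0).1 p + (ω 1).1 p + (ω 2).1 p = 0 ∧
                     (ω 0).2 p + (ω 1).2 p + (ω 2).2 p = 0)
    (hsum' : ∀ p ∈ V, (ω' 0).1 p + (ω' 1).1 p + (ω' 2).1 p = 0 ∧
                      (ω' 0).2 p + (ω' 1).2 p + (ω' 2).2 p = 0)
    (hprod : ∀ p ∈ V,
      symC0 (ω 0) (ω 1) (ω 2) p = symC0 (ω' 0) (ω' 1) (ω' 2) p ∧
      symC1 (ω 0) (ω 1) (ω 2) p = symC1 (ω' 0) (ω' 1) (ω' 2) p ∧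
      symC2 (ω 0) (ω 1) (ω 2) p = symC2 (ω' 0) (ω' 1) (ω' 2) p ∧
      symC3 (ω 0) (ω 1) (ω 2) p = symC3 (ω' 0) (ω' 1) (ω' 2) p) :
    ∃ σ : Equiv.Perm (Fin 3), ∃ ζ : ℂ, ζ ^ 3 = 1 ∧
      ∀ i, ∀ p ∈ V, (ω' i).1 p = ζ * (ω (σ i)).1 p ∧ (ω' i).2 p = ζ * (ω (σ i)).2 p := by
  have : PreconnectedSpace V := isPreconnected_iff_preconnectedSpace.mp hconn.isPreconnected
  have : Nonempty V := hconn.nonempty.to_subtype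
  have : Finite {ζ : ℂ // ζ ^ 3 = 1} :=
    (Polynomial.nthRootsFinset 3 (1 : ℂ)).finite_toSet.subset fun ζ hζ => by
      simpa [Polynomial.mem_nthRootsFinset] using show ζ ^ 3 = 1 from hζ
  have hcont (η : Form1) (h : HoloForm η V) :
      Continuous (fun x : V => η.1 x) ∧ Continuous (fun x : V => η.2 x) :=
    ⟨h.1.continuousOn.domRestrict, h.2.continuousOn.domRestrict⟩
  let C : Equiv.Perm (Fin 3) × {ζ : ℂ // ζ ^ 3 = 1} → Set V := fun k =>
    {x | ∀ i, (ω' i).1 x = k.2 * (ω (k.1 i)).1 x ∧ (ω' i).2 x = k.2 * (ω (k.1 i)).2 x}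
  suffices h : ∃ k, C k = Set.univ by
    obtain ⟨⟨σ, ζ, hζ⟩, hk⟩ := h
    refine ⟨σ, ζ, hζ, fun i p hp => ?_⟩
    have hx : (⟨p, hp⟩ : V) ∈ C (σ, ⟨ζ, hζ⟩) := hk ▸ Set.mem_univ _
    exact hx i
  refine exists_eq_univ_of_finite_closed_partition C ?_ ?_ ?_
  · rintro ⟨σ, ζ⟩
    simp only [C, Set.ofPred_forall]
    refine isClosed_iInter fun i => ?_
    exact (isClosed_eq (hcont _ (hholo' i)).1 ((hcont _ (hholo (σ i))).1.const_mul _)).inter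
      (isClosed_eq (hcont _ (hholo' i)).2 ((hcont _ (hholo (σ i))).2.const_mul _))
  · rintro ⟨σ, ζ, hζ⟩ ⟨τ, ξ, hξ⟩ ⟨p, hp⟩ h1 h2
    have hζ0 : ζ ≠ 0 := by rintro rfl; norm_num at hζ
    have hξ0 : ξ ≠ 0 := by rintro rfl; norm_num at hξ
    have hστ : σ = τ := by
      ext1 i
      by_contra hne
      apply mul_ne_zero (mul_ne_zero hζ0 hξ0) (hwedge _ _ hne p hp)
      obtain ⟨a1, b1⟩ := h1 i
      obtain ⟨a2, b2⟩ := h2 i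
      dsimp only at a1 a2 b1 b2
      unfold wedge
      linear_combination ξ * (ω (τ i)).1 p * b1 - ξ * (ω (τ i)).2 p * a1 +
        (ω' i).2 p * a2 - (ω' i).1 p * b2
    subst hστ
    have hζξ : ζ = ξ := by
      obtain ⟨a1, b1⟩ := h1 0
      obtain ⟨a2, b2⟩ := h2 0
      dsimp only at a1 a2 b1 b2
      have hw := hwedge (σ 0) (σ 1) (σ.injective.ne (by decide)) p hp
      refine sub_eq_zero.mp ((mul_eq_zero.mp ?_).resolve_right hw)
      unfold wedge
      linear_combination (ω (σ 1)).2 p * (a2 - a1) - (ω (σ 1)).1 p * (b2 - b1)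
    subst hζξ
    rfl
  · rintro ⟨p, hp⟩
    obtain ⟨h0, h1, h2, h3⟩ := hprod p hp
    obtain ⟨σ, ζ, hζ, h⟩ := linear_factors_unique
      (fun i => (ω i).1 p) (fun i => (ω i).2 p) (fun i => (ω' i).1 p) (fun i => (ω' i).2 p)
      (fun i j hij => hwedge i j hij p hp) (fun i j hij => hwedge' i j hij p hp)
      (by simpa [Fin.sum_univ_three] using (hsum p hp).1)
      (by simpa [Fin.sum_univ_three] using (hsum p hp).2)
      (by simpa [Fin.sum_univ_three] using (hsum' p hp).1)
      (by simpa [Fin.sum_univ_three] using (hsum' p hp).2)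
      (by
        intro s t
        simp only [Fin.prod_univ_three]
        simp only [symC0, symC1, symC2, symC3] at h0 h1 h2 h3
        linear_combination s ^ 3 * h0 + s ^ 2 * t * h1 + s * t ^ 2 * h2 + t ^ 3 * h3)
    exact ⟨(σ, ⟨ζ, hζ⟩), h⟩
end
end

section
/- Let η be a symmetric 3-differential holomorphic on an open set U ⊆ ℂ × ℂ that is non-degenerate at every point of U, and let x ∈ U. Then there exist an open neighborhood V ⊆ U of x, holomorphic functions u, v on V with the Jacobian u_z·v_w − u_w·v_z nonvanishing on V, and nonvanishing holomorphic functions a, b on V, such that η equals the symmetric product of the three 1-forms a·du + b·dv, du, and dv on V (that is, in the local coordinates (u,v), η takes the form [a du + b dv]·du·dv). -/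
noncomputable section

open Filter Topology Set

/-- The partial derivative in the first variable of a continuous function of two complex variables
that is holomorphic in the first variable is jointly continuous. -/
theorem continuousAt_deriv_fst {V : Set (ℂ × ℂ)} (hV : IsOpen V) {f : ℂ × ℂ → ℂ}
    (hc : ContinuousOn f V) (h₁ : ∀ p ∈ V, DifferentiableAt ℂ (fun z => f (z, p.2)) p.1)
    {p : ℂ × ℂ} (hp : p ∈ V) :
    ContinuousAt (fun q : ℂ × ℂ => deriv (fun z => f (z, q.2)) q.1) p := by
  obtain ⟨ε, hε, hball⟩ := Metric.isOpen_iff.1 hV p hp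
  have hsub : ∀ z ∈ Metric.closedBall p.1 (ε / 2), ∀ w ∈ Metric.ball p.2 ε, (z, w) ∈ V := by
    intro z hz w hw
    refine hball ?_
    rw [← ball_prod_same]
    exact ⟨Metric.closedBall_subset_ball (half_lt_self hε) hz, hw⟩
  have hunif : TendstoUniformlyOn (fun (q : ℂ × ℂ) z => f (z, q.2)) (fun z => f (z, p.2)) (𝓝 p)
      (Metric.ball p.1 (ε / 2)) := by
    have hU : ContinuousOn (fun q : ℂ × ℂ => f (q.2, q.1))
        (Metric.ball p.2 ε ×ˢ Metric.closedBall p.1 (ε / 2)) :=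
      hc.comp (by fun_prop) fun q hq => hsub _ hq.2 _ hq.1
    have : CompactSpace (Metric.closedBall p.1 (ε / 2)) :=
      isCompact_iff_compactSpace.1 (isCompact_closedBall _ _)
    have h := ContinuousOn.tendstoUniformly
      (f := fun w (z : Metric.closedBall p.1 (ε / 2)) => f (z, w))
      (Metric.ball_mem_nhds p.2 hε)
      (hU.comp (f := fun q : ℂ × Metric.closedBall p.1 (ε / 2) => (q.1, (q.2 : ℂ)))
        (by fun_prop) fun q hq => ⟨hq.1, q.2.2⟩)
    have h' := (tendstoUniformlyOn_iff_tendstoUniformly_comp_coe (s := Metric.closedBall p.1 (ε / 2))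
      (F := fun w z => f (z, w)) (f := fun z => f (z, p.2))).2 h
    exact fun u hu => (continuous_snd.tendsto p).eventually
      ((h'.mono Metric.ball_subset_closedBall) u hu)
  have hdiff : ∀ᶠ q : ℂ × ℂ in 𝓝 p,
      DifferentiableOn ℂ (fun z => f (z, q.2)) (Metric.ball p.1 (ε / 2)) := by
    filter_upwards [(continuous_snd.tendsto p).eventually (Metric.ball_mem_nhds p.2 hε)] with q hq
    exact fun z hz => (h₁ (z, q.2)
      (hsub _ (Metric.ball_subset_closedBall hz) _ hq)).differentiableWithinAt
  have hlim := hunif.tendstoLocallyUniformlyOn.deriv hdiff Metric.isOpen_ball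
  have hmem : Metric.ball p.1 (ε / 2) ∈ 𝓝 p.1 := Metric.ball_mem_nhds _ (half_pos hε)
  have hcont : ContinuousWithinAt (deriv fun z => f (z, p.2)) (Metric.ball p.1 (ε / 2)) p.1 :=
    ((hdiff.self_of_nhds.deriv Metric.isOpen_ball).continuousOn p.1
      (Metric.mem_ball_self (half_pos hε)))
  refine hlim.tendsto_comp (g := fun q : ℂ × ℂ => q.1) hcont
    (Metric.mem_ball_self (half_pos hε)) ?_
  rw [nhdsWithin_eq_nhds.2 hmem]
  exact continuous_fst.tendsto p

/-- A function of two variables with continuous partial derivatives is continuously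
differentiable. -/
theorem contDiffOn_one_of_continuousOn_partial {V : Set (ℂ × ℂ)} (hV : IsOpen V)
    {f g₁ g₂ : ℂ × ℂ → ℂ} (c₁ : ContinuousOn g₁ V) (c₂ : ContinuousOn g₂ V)
    (h₁ : ∀ p ∈ V, HasDerivAt (fun z => f (z, p.2)) (g₁ p) p.1)
    (h₂ : ∀ p ∈ V, HasDerivAt (fun w => f (p.1, w)) (g₂ p) p.2) : ContDiffOn ℂ 1 f V := by
  have hcont : ∀ {g : ℂ × ℂ → ℂ}, ContinuousOn g V →
      ContinuousOn (fun q => ContinuousLinearMap.toSpanSingleton ℂ (g q)) V := by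
    intro g hg
    rw [continuousOn_clm_apply]
    intro y
    simp only [ContinuousLinearMap.toSpanSingleton_apply]
    fun_prop
  have hstrict : ∀ p ∈ V, HasStrictFDerivAt f
      ((ContinuousLinearMap.toSpanSingleton ℂ (g₁ p)).coprod
        (ContinuousLinearMap.toSpanSingleton ℂ (g₂ p))) p := by
    intro p hp
    refine hasStrictFDerivAt_uncurry_coprod (f := fun z w => f (z, w))
      (f₁ := fun z w => ContinuousLinearMap.toSpanSingleton ℂ (g₁ (z, w)))
      (f₂ := fun z w => ContinuousLinearMap.toSpanSingleton ℂ (g₂ (z, w)))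
      ?_ ?_ ((hcont c₁).continuousAt (hV.mem_nhds hp)) ((hcont c₂).continuousAt (hV.mem_nhds hp))
    · filter_upwards [hV.mem_nhds hp] with v hv using (h₁ v hv).hasFDerivAt
    · filter_upwards [hV.mem_nhds hp] with v hv using (h₂ v hv).hasFDerivAt
  intro p hp
  refine (contDiffAt_one_iff.2 ⟨_, V, hV.mem_nhds hp, ?_,
    fun q hq => (hstrict q hq).hasFDerivAt⟩).contDiffWithinAt
  rw [continuousOn_clm_apply]
  intro y
  simp only [ContinuousLinearMap.coprod_apply, ContinuousLinearMap.toSpanSingleton_apply]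
  fun_prop

/-- Osgood's lemma in two variables. -/
theorem contDiffOn_of_separately_holomorphic {V : Set (ℂ × ℂ)} (hV : IsOpen V) {f : ℂ × ℂ → ℂ}
    (hc : ContinuousOn f V) (h₁ : ∀ p ∈ V, DifferentiableAt ℂ (fun z => f (z, p.2)) p.1)
    (h₂ : ∀ p ∈ V, DifferentiableAt ℂ (fun w => f (p.1, w)) p.2) : ContDiffOn ℂ 1 f V := by
  refine contDiffOn_one_of_continuousOn_partial hV (fun p hp =>
    (continuousAt_deriv_fst hV hc h₁ hp).continuousWithinAt) (fun p hp => ?_)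
    (fun p hp => (h₁ p hp).hasDerivAt) (fun p hp => (h₂ p hp).hasDerivAt)
  have := continuousAt_deriv_fst (V := Prod.swap ⁻¹' V) (f := f ∘ Prod.swap) (p := p.swap)
    (hV.preimage continuous_swap) (hc.comp continuous_swap.continuousOn fun _ h => h)
    (fun q hq => h₂ q.swap hq) (by simpa using hp)
  simp only [Function.comp_apply, Prod.swap_prod_mk] at this
  exact (ContinuousAt.comp (g := fun q : ℂ × ℂ => deriv (fun w => f (q.2, w)) q.1)
    (f := Prod.swap) this continuous_swap.continuousAt).continuousWithinAt

theorem contDiffOn_one_of_differentiableOn {V : Set (ℂ × ℂ)} (hV : IsOpen V) {f : ℂ × ℂ → ℂ}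
    (hf : DifferentiableOn ℂ f V) : ContDiffOn ℂ 1 f V := by
  refine contDiffOn_of_separately_holomorphic hV hf.continuousOn (fun p hp => ?_) fun p hp => ?_
  · exact DifferentiableAt.comp (f := fun z => (z, p.2)) p.1
      (hf.differentiableAt (hV.mem_nhds hp)) (by fun_prop)
  · exact DifferentiableAt.comp (f := fun w => (p.1, w)) p.2
      (hf.differentiableAt (hV.mem_nhds hp)) (by fun_prop)

/-- Locally uniform limits of holomorphic functions of two variables are holomorphic. -/
theorem differentiableOn_of_tendstoLocallyUniformlyOn_prod {ι : Type*} {l : Filter ι} [l.NeBot]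
    {V : Set (ℂ × ℂ)} (hV : IsOpen V) {F : ι → ℂ × ℂ → ℂ} {f : ℂ × ℂ → ℂ}
    (hF : ∀ᶠ n in l, DifferentiableOn ℂ (F n) V) (h : TendstoLocallyUniformlyOn F f l V) :
    DifferentiableOn ℂ f V := by
  refine (contDiffOn_of_separately_holomorphic hV
    (h.continuousOn (hF.mono fun n hn => hn.continuousOn).frequently)
    (fun p hp => ?_) fun p hp => ?_).differentiableOn one_ne_zero
  · have hc : Continuous fun z : ℂ => (z, p.2) := by fun_prop
    refine ((h.comp (fun z : ℂ => (z, p.2)) (mapsTo_preimage _ V)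
      hc.continuousOn).differentiableOn ?_ (hV.preimage hc)).differentiableAt
      ((hV.preimage hc).mem_nhds hp)
    filter_upwards [hF] with n hn
    exact hn.comp (by fun_prop) (mapsTo_preimage _ V)
  · have hc : Continuous fun w : ℂ => (p.1, w) := by fun_prop
    refine ((h.comp (fun w : ℂ => (p.1, w)) (mapsTo_preimage _ V)
      hc.continuousOn).differentiableOn ?_ (hV.preimage hc)).differentiableAt
      ((hV.preimage hc).mem_nhds hp)
    filter_upwards [hF] with n hn
    exact hn.comp (by fun_prop) (mapsTo_preimage _ V)

/-- Directional derivatives of holomorphic functions of two variables are holomorphic. -/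
theorem differentiableOn_fderiv_apply {V : Set (ℂ × ℂ)} (hV : IsOpen V) {f : ℂ × ℂ → ℂ}
    (hf : DifferentiableOn ℂ f V) (e : ℂ × ℂ) : DifferentiableOn ℂ (fun p => fderiv ℂ f p e) V := by
  have hC := contDiffOn_one_of_differentiableOn hV hf
  have hcont : ContinuousOn (fun p => fderiv ℂ f p e) V :=
    (hC.continuousOn_fderiv_of_isOpen hV le_rfl).clm_apply continuousOn_const
  intro x hx
  obtain ⟨ε, hε, hball⟩ := Metric.isOpen_iff.1 hV x hx
  have hs : Tendsto (fun h : ℂ => h • e) (𝓝[≠] 0) (𝓝 0) := by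
    have : Tendsto (fun h : ℂ => h • e) (𝓝 0) (𝓝 ((0 : ℂ) • e)) := by
      apply Continuous.tendsto; fun_prop
    rw [zero_smul] at this
    exact this.mono_left nhdsWithin_le_nhds
  have key : TendstoLocallyUniformlyOn (fun (h : ℂ) p => h⁻¹ * (f (p + h • e) - f p))
      (fun p => fderiv ℂ f p e) (𝓝[≠] 0) V := by
    rw [Metric.tendstoLocallyUniformlyOn_iff]
    intro δ hδ p hp
    have hst := (hC.contDiffAt (hV.mem_nhds hp)).hasStrictFDerivAt one_ne_zero
    set c := δ / (2 * (‖e‖ + 1)) with hcdef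
    have hcpos : 0 < c := by positivity
    have hb := hst.isLittleO.def hcpos
    rw [nhds_prod_eq, eventually_prod_iff] at hb
    obtain ⟨P, hP, Q, hQ, hPQ⟩ := hb
    obtain ⟨ρ, hρ, hPρ⟩ := Metric.eventually_nhds_iff_ball.1 hP
    have hnear : ∀ᶠ q in 𝓝 p, dist (fderiv ℂ f q e) (fderiv ℂ f p e) < δ / 2 :=
      (hcont.continuousAt (hV.mem_nhds hp)).eventually (Metric.ball_mem_nhds _ (half_pos hδ))
    refine ⟨{q | q ∈ Metric.ball p (ρ / 2) ∧ Q q ∧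
        dist (fderiv ℂ f q e) (fderiv ℂ f p e) < δ / 2}, mem_nhdsWithin_of_mem_nhds
        (inter_mem (Metric.ball_mem_nhds p (half_pos hρ)) (inter_mem hQ hnear)), ?_⟩
    filter_upwards [hs.eventually (Metric.ball_mem_nhds 0 (half_pos hρ)),
      self_mem_nhdsWithin] with h hh hh0 q hq
    have hh0 : h ≠ 0 := hh0
    obtain ⟨hq1, hq2, hq3⟩ := hq
    have hmem : q + h • e ∈ Metric.ball p ρ := by
      rw [dist_zero_right] at hh
      rw [mem_ball_iff_norm] at hq1 ⊢
      calc ‖q + h • e - p‖ = ‖(q - p) + h • e‖ := by congr 1; abel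
        _ ≤ ‖q - p‖ + ‖h • e‖ := norm_add_le _ _
        _ < ρ := by linarith
    have hle := hPQ (hPρ _ hmem) hq2
    simp only [add_sub_cancel_left, map_smul, smul_eq_mul, norm_smul] at hle
    have e1 : h⁻¹ * (f (q + h • e) - f q) - fderiv ℂ f p e
        = h⁻¹ * (f (q + h • e) - f q - h * fderiv ℂ f p e) := by field_simp
    have hq4 : ‖h⁻¹ * (f (q + h • e) - f q) - fderiv ℂ f p e‖ < δ / 2 := by
      rw [e1, norm_mul, norm_inv]
      have hhpos : 0 < ‖h‖ := norm_pos_iff.2 hh0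
      rw [inv_mul_lt_iff₀ hhpos]
      refine hle.trans_lt ?_
      have : c * ‖e‖ < δ / 2 := by
        rw [hcdef, div_mul_eq_mul_div, div_lt_div_iff₀ (by positivity) (by positivity)]
        nlinarith [norm_nonneg e]
      nlinarith
    rw [dist_comm]
    refine (dist_triangle _ (fderiv ℂ f p e) _).trans_lt ?_
    rw [dist_eq_norm_sub, dist_comm (fderiv ℂ f p e)]
    linarith
  have hsub : Metric.ball x (ε / 2) ⊆ V := (Metric.ball_subset_ball (by linarith)).trans hball
  refine ((differentiableOn_of_tendstoLocallyUniformlyOn_prod Metric.isOpen_ball ?_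
    (key.mono hsub)).differentiableAt
    (Metric.ball_mem_nhds x (half_pos hε))).differentiableWithinAt
  filter_upwards [hs.eventually (Metric.ball_mem_nhds 0 (half_pos hε))] with h hh
  have hmaps : MapsTo (fun p : ℂ × ℂ => p + h • e) (Metric.ball x (ε / 2)) V := by
    intro q hq
    apply hball
    rw [dist_zero_right] at hh
    rw [mem_ball_iff_norm] at hq ⊢
    calc ‖q + h • e - x‖ = ‖(q - x) + h • e‖ := by congr 1; abel
      _ ≤ ‖q - x‖ + ‖h • e‖ := norm_add_le _ _
      _ < ε := by linarith
  exact ((hf.comp (by fun_prop) hmaps).sub (hf.mono hsub)).const_mul _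

/-- The primitive, in the first variable, of `h`, vanishing at `z₀`. -/
def fstPrimitive (z₀ : ℂ) (h : ℂ × ℂ → ℂ) (p : ℂ × ℂ) : ℂ :=
  (p.1 - z₀) * ∫ t in (0 : ℝ)..1, h (z₀ + t • (p.1 - z₀), p.2)

theorem add_smul_sub_mem_ball {z₀ z : ℂ} {r t : ℝ} (hz : z ∈ Metric.ball z₀ r)
    (ht : t ∈ Icc (0 : ℝ) 1) : z₀ + t • (z - z₀) ∈ Metric.ball z₀ r := by
  rw [mem_ball_iff_norm, add_sub_cancel_left, norm_smul, Real.norm_of_nonneg ht.1]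
  rw [mem_ball_iff_norm] at hz
  nlinarith [norm_nonneg (z - z₀), ht.1, ht.2]

theorem hasDerivAt_fstPrimitive {z₀ : ℂ} {r : ℝ} {S : Set ℂ} {h : ℂ × ℂ → ℂ}
    (hh : DifferentiableOn ℂ h (Metric.ball z₀ r ×ˢ S)) {p : ℂ × ℂ}
    (hp : p ∈ Metric.ball z₀ r ×ˢ S) :
    HasDerivAt (fun z => fstPrimitive z₀ h (z, p.2)) (h p) p.1 := by
  have hd : DifferentiableOn ℂ (fun z => h (z, p.2)) (Metric.ball z₀ r) :=
    hh.comp (by fun_prop) fun z hz => ⟨hz, hp.2⟩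
  obtain ⟨k, hk0, hk⟩ := hd.isExactOn_ball.with_val_at z₀ 0
  refine (hk p.1 hp.1).congr_of_eventuallyEq ?_
  filter_upwards [Metric.isOpen_ball.mem_nhds hp.1] with z hz
  have := intervalIntegral.integral_unitInterval_deriv_eq_sub (𝕜 := ℂ) (f := k)
    (f' := fun z => h (z, p.2)) (z₀ := z₀) (z₁ := z - z₀)
    (hd.continuousOn.comp (by fun_prop) fun t ht => add_smul_sub_mem_ball hz ht)
    fun t ht => hk _ (add_smul_sub_mem_ball hz ht)
  simpa [fstPrimitive, hk0] using this

theorem differentiableOn_fstPrimitive {z₀ : ℂ} {r : ℝ} {S : Set ℂ} (hS : IsOpen S)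
    {h : ℂ × ℂ → ℂ} (hh : DifferentiableOn ℂ h (Metric.ball z₀ r ×ˢ S)) :
    DifferentiableOn ℂ (fstPrimitive z₀ h) (Metric.ball z₀ r ×ˢ S) := by
  have hV : IsOpen (Metric.ball z₀ r ×ˢ S) := Metric.isOpen_ball.prod hS
  set γ : ℝ → ℂ × ℂ → ℂ × ℂ := fun t q => (z₀ + t • (q.1 - z₀), q.2) with hγ
  have hγc : Continuous fun a : (ℂ × ℂ) × ℝ => γ a.2 a.1 := by fun_prop
  have hγd : ∀ t q, HasFDerivAt (γ t)
      ((t • ContinuousLinearMap.fst ℂ ℂ ℂ).prod (ContinuousLinearMap.snd ℂ ℂ ℂ)) q := fun t q =>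
    (((hasFDerivAt_fst.sub_const z₀).const_smul t).const_add z₀).prodMk hasFDerivAt_snd
  have hmaps : ∀ q ∈ Metric.ball z₀ r ×ˢ S, ∀ t ∈ Icc (0 : ℝ) 1,
      γ t q ∈ Metric.ball z₀ r ×ˢ S :=
    fun q hq t ht => ⟨add_smul_sub_mem_ball hq.1 ht, hq.2⟩
  set F' : ℂ × ℂ → ℝ → (ℂ × ℂ →L[ℂ] ℂ) := fun q t => (fderiv ℂ h (γ t q)).comp
    ((t • ContinuousLinearMap.fst ℂ ℂ ℂ).prod (ContinuousLinearMap.snd ℂ ℂ ℂ)) with hF'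
  have hF'c : ContinuousOn (fun a : (ℂ × ℂ) × ℝ => F' a.1 a.2)
      ((Metric.ball z₀ r ×ˢ S) ×ˢ Icc 0 1) := by
    refine ContinuousOn.clm_comp ?_ ?_
    · exact ((contDiffOn_one_of_differentiableOn hV hh).continuousOn_fderiv_of_isOpen hV
        le_rfl).comp hγc.continuousOn fun a ha => hmaps _ ha.1 _ ha.2
    · rw [continuousOn_clm_apply]
      intro y
      simp only [ContinuousLinearMap.prod_apply, smul_apply]
      fun_prop
  have hFc : ∀ q ∈ Metric.ball z₀ r ×ˢ S, ContinuousOn (fun t => h (γ t q)) (uIcc 0 1) := by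
    intro q hq
    rw [uIcc_of_le zero_le_one]
    exact hh.continuousOn.comp (by fun_prop) fun t ht => hmaps q hq t ht
  intro p hp
  obtain ⟨K, hKc, hKp, hKs⟩ : ∃ K, IsCompact K ∧ K ∈ 𝓝 p ∧ K ⊆ Metric.ball z₀ r ×ˢ S := by
    obtain ⟨K, hK, hKs, hKc⟩ := local_compact_nhds (hV.mem_nhds hp)
    exact ⟨K, hKc, hK, hKs⟩
  obtain ⟨C, hC⟩ := (hKc.prod isCompact_Icc).exists_bound_of_continuousOn
    (hF'c.mono (prod_mono hKs Subset.rfl))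
  have hint : DifferentiableAt ℂ (fun q => ∫ t in (0 : ℝ)..1, h (γ t q)) p := by
    refine (intervalIntegral.hasFDerivAt_integral_of_dominated_of_fderiv_le (F' := F')
      (bound := fun _ => C) hKp ?_ (hFc p hp).intervalIntegrable ?_ ?_ (by simp)
      ?_).differentiableAt
    · filter_upwards [hV.mem_nhds hp] with q hq
      exact (intervalIntegrable_iff.1 (hFc q hq).intervalIntegrable).aestronglyMeasurable
    · have : ContinuousOn (F' p) (uIcc 0 1) := by
        rw [uIcc_of_le zero_le_one]
        exact hF'c.comp (f := fun t => (p, t)) (by fun_prop) fun t ht => ⟨hp, ht⟩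
      exact (intervalIntegrable_iff.1 this.intervalIntegrable).aestronglyMeasurable
    · refine .of_forall fun t ht q hq => hC (q, t) ⟨hq, ?_⟩
      rw [uIoc_of_le zero_le_one] at ht
      exact Ioc_subset_Icc_self ht
    · refine .of_forall fun t ht q hq => ?_
      rw [uIoc_of_le zero_le_one] at ht
      exact (hh.differentiableAt (hV.mem_nhds
        (hmaps q (hKs hq) t (Ioc_subset_Icc_self ht)))).hasFDerivAt.comp q (hγd t q)
  exact (DifferentiableAt.mul (by fun_prop) hint).differentiableWithinAt

theorem norm_fstPrimitive_sub_le {z₀ : ℂ} {r C : ℝ} {S : Set ℂ}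
    {h k : ℂ × ℂ → ℂ} (hh : DifferentiableOn ℂ h (Metric.ball z₀ r ×ˢ S))
    (hk : DifferentiableOn ℂ k (Metric.ball z₀ r ×ˢ S))
    (hC : ∀ p ∈ Metric.ball z₀ r ×ˢ S, ‖h p - k p‖ ≤ C) {p : ℂ × ℂ}
    (hp : p ∈ Metric.ball z₀ r ×ˢ S) :
    ‖fstPrimitive z₀ h p - fstPrimitive z₀ k p‖ ≤ C * r := by
  have hz₀ : z₀ ∈ Metric.ball z₀ r := Metric.mem_ball_self (Metric.pos_of_mem_ball hp.1)
  have hle := (convex_ball z₀ r).norm_image_sub_le_of_norm_hasDerivWithin_le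
    (f := fun z => fstPrimitive z₀ h (z, p.2) - fstPrimitive z₀ k (z, p.2))
    (fun z hz => ((hasDerivAt_fstPrimitive hh (p := (z, p.2)) ⟨hz, hp.2⟩).sub
      (hasDerivAt_fstPrimitive hk (p := (z, p.2)) ⟨hz, hp.2⟩)).hasDerivWithinAt)
    (fun z hz => hC (z, p.2) ⟨hz, hp.2⟩) hz₀ hp.1
  have hC0 : 0 ≤ C := (norm_nonneg _).trans (hC p hp)
  have hpr := mem_ball_iff_norm.1 hp.1
  simp only [fstPrimitive, sub_self, zero_mul, sub_zero] at hle ⊢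
  exact hle.trans (mul_le_mul_of_nonneg_left hpr.le hC0)

/-- The solution of `∂Φ/∂z = g (z, Φ)`, `Φ (z₀, c) = c` exists and is holomorphic in `(z, c)`. -/
theorem exists_holomorphic_flow {z₀ w₀ : ℂ} {r R M K : ℝ} {g : ℂ × ℂ → ℂ} (hr : 0 < r)
    (hK0 : 0 ≤ K)
    (hg : DifferentiableOn ℂ g (Metric.ball z₀ r ×ˢ Metric.ball w₀ (2 * R)))
    (hM : ∀ p ∈ Metric.ball z₀ r ×ˢ Metric.ball w₀ (2 * R), ‖g p‖ ≤ M) (hMr : M * r ≤ R)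
    (hK : ∀ z ∈ Metric.ball z₀ r, ∀ w ∈ Metric.ball w₀ (2 * R), ∀ w' ∈ Metric.ball w₀ (2 * R),
      ‖g (z, w) - g (z, w')‖ ≤ K * ‖w - w'‖) (hKr : K * r ≤ 1 / 2) :
    ∃ Φ : ℂ × ℂ → ℂ, DifferentiableOn ℂ Φ (Metric.ball z₀ r ×ˢ Metric.ball w₀ R) ∧
      (∀ p ∈ Metric.ball z₀ r ×ˢ Metric.ball w₀ R,
        HasDerivAt (fun z => Φ (z, p.2)) (g (p.1, Φ p)) p.1) ∧
      ∀ c ∈ Metric.ball w₀ R, Φ (z₀, c) = c := by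
  set D := Metric.ball z₀ r ×ˢ Metric.ball w₀ R with hD
  have hDo : IsOpen D := Metric.isOpen_ball.prod Metric.isOpen_ball
  let Adm : (ℂ × ℂ → ℂ) → Prop := fun f => DifferentiableOn ℂ f D ∧ ∀ p ∈ D, ‖f p - p.2‖ ≤ R
  let T : (ℂ × ℂ → ℂ) → ℂ × ℂ → ℂ := fun f p => p.2 + fstPrimitive z₀ (fun q => g (q.1, f q)) p
  have hmem : ∀ {f}, Adm f → ∀ p ∈ D, f p ∈ Metric.ball w₀ (2 * R) := by
    intro f hf p hp
    have h1 := hf.2 p hp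
    have h2 := mem_ball_iff_norm.1 hp.2
    rw [mem_ball_iff_norm]
    calc ‖f p - w₀‖ = ‖(f p - p.2) + (p.2 - w₀)‖ := by congr 1; ring
      _ ≤ ‖f p - p.2‖ + ‖p.2 - w₀‖ := norm_add_le _ _
      _ < 2 * R := by linarith
  have hcomp : ∀ {f}, Adm f → DifferentiableOn ℂ (fun q => g (q.1, f q)) D := fun {f} hf =>
    hg.comp (differentiableOn_fst.prodMk hf.1) fun q hq => ⟨hq.1, hmem hf q hq⟩
  have hTAdm : ∀ {f}, Adm f → Adm (T f) := by
    intro f hf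
    refine ⟨differentiableOn_snd.add (differentiableOn_fstPrimitive Metric.isOpen_ball (hcomp hf)),
      fun p hp => ?_⟩
    have := norm_fstPrimitive_sub_le (k := fun _ => 0) (C := M) (hcomp hf)
      (differentiableOn_const 0)
      (fun q hq => by simpa using hM (q.1, f q) ⟨hq.1, hmem hf q hq⟩) hp
    simp only [T, add_sub_cancel_left]
    simp only [fstPrimitive, intervalIntegral.integral_zero, mul_zero, sub_zero] at this ⊢
    exact this.trans hMr
  have hTlip : ∀ {f k ε}, Adm f → Adm k → (∀ p ∈ D, ‖f p - k p‖ ≤ ε) →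
      ∀ p ∈ D, ‖T f p - T k p‖ ≤ ε / 2 := by
    intro f k ε hf hk hε p hp
    have hε0 : 0 ≤ ε := (norm_nonneg _).trans (hε p hp)
    have := norm_fstPrimitive_sub_le (C := K * ε) (hcomp hf) (hcomp hk)
      (fun q hq => (hK _ hq.1 _ (hmem hf q hq) _ (hmem hk q hq)).trans
        (mul_le_mul_of_nonneg_left (hε q hq) hK0)) hp
    simp only [T, add_sub_add_left_eq_sub]
    refine this.trans ?_
    nlinarith
  let s : ℕ → ℂ × ℂ → ℂ := fun n => T^[n] Prod.snd
  have hs_succ : ∀ n, s (n + 1) = T (s n) := fun n => Function.iterate_succ_apply' T n _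
  have hsAdm : ∀ n, Adm (s n) := by
    intro n
    induction n with
    | zero =>
      refine ⟨differentiableOn_snd, fun p hp => ?_⟩
      simpa [s] using (Metric.pos_of_mem_ball hp.2).le
    | succ n ih => rw [hs_succ]; exact hTAdm ih
  have hsdist : ∀ n, ∀ p ∈ D, ‖s n p - s (n + 1) p‖ ≤ R * (1 / 2) ^ n := by
    intro n
    induction n with
    | zero =>
      intro p hp
      rw [norm_sub_rev]
      simpa [s] using (hsAdm 1).2 p hp
    | succ n ih =>
      intro p hp
      have := hTlip (hsAdm n) (hsAdm (n + 1)) ih p hp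
      rw [hs_succ (n + 1)]
      nth_rewrite 1 [hs_succ n]
      refine this.trans_eq ?_
      ring
  let Φ : ℂ × ℂ → ℂ := fun p => limUnder atTop fun n => s n p
  have hΦ : ∀ p ∈ D, Tendsto (fun n => s n p) atTop (𝓝 (Φ p)) := fun p hp =>
    (cauchySeq_of_le_geometric (1 / 2) R (by norm_num) fun n => by
      simpa only [dist_eq_norm_sub] using hsdist n p hp).tendsto_limUnder
  have hΦdist : ∀ n, ∀ p ∈ D, ‖s n p - Φ p‖ ≤ R * (1 / 2) ^ n / (1 - 1 / 2) := by
    intro n p hp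
    have := dist_le_of_le_geometric_of_tendsto (1 / 2) R (by norm_num) (fun n => by
      simpa only [dist_eq_norm_sub] using hsdist n p hp) (hΦ p hp) n
    simpa only [dist_eq_norm_sub] using this
  have hlim0 : Tendsto (fun n : ℕ => R * (1 / 2 : ℝ) ^ n / (1 - 1 / 2)) atTop (𝓝 0) := by
    have := ((tendsto_pow_atTop_nhds_zero_of_lt_one (r := (1 / 2 : ℝ)) (by norm_num)
      (by norm_num)).const_mul R).div_const (1 - 1 / 2)
    simpa using this
  have hunif : TendstoUniformlyOn s Φ atTop D := by
    rw [Metric.tendstoUniformlyOn_iff]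
    intro ε hε
    filter_upwards [hlim0.eventually (gt_mem_nhds hε)] with n hn p hp
    rw [dist_comm, dist_eq_norm_sub]
    exact (hΦdist n p hp).trans_lt hn
  have hΦAdm : Adm Φ := by
    refine ⟨differentiableOn_of_tendstoLocallyUniformlyOn_prod hDo
      (.of_forall fun n => (hsAdm n).1) hunif.tendstoLocallyUniformlyOn, fun p hp => ?_⟩
    exact le_of_tendsto ((hΦ p hp).sub_const p.2).norm (.of_forall fun n => (hsAdm n).2 p hp)
  have hfix : ∀ p ∈ D, Φ p = T Φ p := by
    intro p hp
    refine tendsto_nhds_unique ((hΦ p hp).comp (tendsto_add_atTop_nat 1)) ?_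
    rw [tendsto_iff_norm_sub_tendsto_zero]
    have h2 := hlim0.div_const 2
    rw [zero_div] at h2
    refine squeeze_zero (fun _ => norm_nonneg _) (fun n => ?_) h2
    simp only [Function.comp_apply, hs_succ]
    exact hTlip (hsAdm n) hΦAdm (hΦdist n) p hp
  refine ⟨Φ, hΦAdm.1, fun p hp => ?_, fun c hc => ?_⟩
  · have := (hasDerivAt_fstPrimitive (hcomp hΦAdm) hp).const_add p.2
    refine this.congr_of_eventuallyEq ?_
    filter_upwards [Metric.isOpen_ball.mem_nhds hp.1] with z hz
    exact hfix (z, p.2) ⟨hz, hp.2⟩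
  · rw [hfix (z₀, c) ⟨Metric.mem_ball_self hr, hc⟩]
    simp [T, fstPrimitive]

theorem exists_integrating_factor_of_snd_ne_zero {P Q : ℂ × ℂ → ℂ} {x : ℂ × ℂ}
    (hP : ∀ᶠ p in 𝓝 x, DifferentiableAt ℂ P p) (hQ : ∀ᶠ p in 𝓝 x, DifferentiableAt ℂ Q p)
    (hx : Q x ≠ 0) :
    ∃ u f : ℂ × ℂ → ℂ, ∀ᶠ p in 𝓝 x, DifferentiableAt ℂ u p ∧ DifferentiableAt ℂ f p ∧
      f p ≠ 0 ∧ P p = f p * pz u p ∧ Q p = f p * pw u p := by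
  obtain ⟨z₀, w₀⟩ := x
  have hQ0 : ∀ᶠ p in 𝓝 (z₀, w₀), Q p ≠ 0 := hQ.self_of_nhds.continuousAt.eventually_ne hx
  set g : ℂ × ℂ → ℂ := fun p => -P p / Q p with hgdef
  have hg : ∀ᶠ p in 𝓝 (z₀, w₀), DifferentiableAt ℂ g p := by
    filter_upwards [hP, hQ, hQ0] with p h1 h2 h3
    simpa only [hgdef, div_eq_mul_inv] using h1.fun_neg.fun_mul (h2.fun_inv h3)
  obtain ⟨V, hVg, hVo, hVx⟩ := eventually_nhds_iff.1 hg
  have hgs := ((contDiffOn_one_of_differentiableOn hVo fun p hp =>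
    (hVg p hp).differentiableWithinAt).contDiffAt (hVo.mem_nhds hVx)).hasStrictFDerivAt one_ne_zero
  obtain ⟨K, s, hs, hKs⟩ := hgs.exists_lipschitzOnWith
  have hM : ∀ᶠ p in 𝓝 (z₀, w₀), ‖g p‖ < ‖g (z₀, w₀)‖ + 1 :=
    hg.self_of_nhds.continuousAt.norm.eventually (gt_mem_nhds (lt_add_one _))
  obtain ⟨ε, hε, hball⟩ := Metric.eventually_nhds_iff_ball.1
    ((hVo.eventually_mem hVx).and (hM.and hs))
  set M := ‖g (z₀, w₀)‖ + 1
  have hMpos : 0 < M := by positivity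
  set R := ε / 2 with hR
  have hRpos : 0 < R := half_pos hε
  set r := min ε (min (R / M) (1 / (2 * (K + 1)))) with hr
  have hrpos : 0 < r := by positivity
  have hsub : ∀ p ∈ Metric.ball z₀ r ×ˢ Metric.ball w₀ (2 * R), p ∈ Metric.ball (z₀, w₀) ε := by
    intro p hp
    rw [← ball_prod_same]
    refine ⟨Metric.ball_subset_ball (min_le_left _ _) hp.1, ?_⟩
    have : 2 * R = ε := by rw [hR]; ring
    exact this ▸ hp.2
  obtain ⟨Φ, hΦ, hΦz, hΦ0⟩ := exists_holomorphic_flow (z₀ := z₀) (w₀ := w₀) (r := r) (R := R)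
    (M := M) (K := K) (g := g) hrpos K.2
    (fun p hp => (hVg p (hball p (hsub p hp)).1).differentiableWithinAt)
    (fun p hp => (hball p (hsub p hp)).2.1.le)
    (by
      have : r ≤ R / M := (min_le_right _ _).trans (min_le_left _ _)
      rw [le_div_iff₀ hMpos] at this
      linarith)
    (fun z hz w hw w' hw' => by
      have := hKs.norm_sub_le (hball _ (hsub (z, w) ⟨hz, hw⟩)).2.2
        (hball _ (hsub (z, w') ⟨hz, hw'⟩)).2.2
      simpa [Prod.norm_def] using this)
    (by
      have h1 : r ≤ 1 / (2 * (K + 1)) := (min_le_right _ _).trans (min_le_right _ _)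
      have hK : (0 : ℝ) ≤ K := K.2
      rw [le_div_iff₀ (by positivity)] at h1
      nlinarith)
  set D := Metric.ball z₀ r ×ˢ Metric.ball w₀ R with hD
  have hDo : IsOpen D := Metric.isOpen_ball.prod Metric.isOpen_ball
  have hDx : (z₀, w₀) ∈ D := ⟨Metric.mem_ball_self hrpos, Metric.mem_ball_self hRpos⟩
  have hΦ1 : ContDiffAt ℂ 1 Φ (z₀, w₀) :=
    (contDiffOn_one_of_differentiableOn hDo hΦ).contDiffAt (hDo.mem_nhds hDx)
  set G : (ℂ × ℂ) × ℂ → ℂ := fun a => Φ (a.1.1, a.2) - a.1.2 with hG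
  have hGc : ContDiffAt ℂ 1 G ((z₀, w₀), w₀) := by
    refine ContDiffAt.sub ?_ (by fun_prop)
    exact ContDiffAt.comp (f := fun a : (ℂ × ℂ) × ℂ => (a.1.1, a.2)) _ hΦ1 (by fun_prop)
  have hGinv : (fderiv ℂ G ((z₀, w₀), w₀) ∘L .inr ℂ (ℂ × ℂ) ℂ).IsInvertible := by
    have h1 : HasFDerivAt (fun y : ℂ => G ((z₀, w₀), y))
        (fderiv ℂ G ((z₀, w₀), w₀) ∘L .inr ℂ (ℂ × ℂ) ℂ) w₀ :=
      (hGc.differentiableAt one_ne_zero).hasFDerivAt.comp w₀ (hasFDerivAt_prodMk_right _ _)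
    have h2 : HasFDerivAt (fun y : ℂ => G ((z₀, w₀), y)) (.id ℂ ℂ) w₀ := by
      refine ((hasFDerivAt_id w₀).sub_const w₀).congr_of_eventuallyEq ?_
      filter_upwards [Metric.ball_mem_nhds w₀ hRpos] with c hc
      simp [G, hΦ0 c hc]
    rw [h1.unique h2]
    exact ⟨.refl ℂ ℂ, rfl⟩
  set ψ := hGc.implicitFunction one_ne_zero hGinv with hψ
  have hψ0 : ψ (z₀, w₀) = w₀ := hGc.implicitFunction_apply_self one_ne_zero hGinv
  have hψc : ContDiffAt ℂ 1 ψ (z₀, w₀) := hGc.contDiffAt_implicitFunction one_ne_zero hGinv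
  have hψd : ∀ᶠ p in 𝓝 (z₀, w₀), DifferentiableAt ℂ ψ p :=
    (hψc.eventually (by simp)).mono fun p hp => hp.differentiableAt one_ne_zero
  have hψeq : ∀ᶠ p in 𝓝 (z₀, w₀), Φ (p.1, ψ p) = p.2 := by
    filter_upwards [hGc.eventually_apply_implicitFunction one_ne_zero hGinv] with p hp
    simpa [G, hΦ0 w₀ hDx.2, sub_eq_zero] using hp
  have hψD : ∀ᶠ p : ℂ × ℂ in 𝓝 (z₀, w₀), (p.1, ψ p) ∈ D := by
    have : ContinuousAt (fun p : ℂ × ℂ => (p.1, ψ p)) (z₀, w₀) :=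
      continuousAt_fst.prodMk hψc.continuousAt
    refine this.eventually_mem (hDo.mem_nhds ?_)
    simpa [hψ0] using hDx
  refine ⟨ψ, fun p => Q p * pw Φ (p.1, ψ p), ?_⟩
  filter_upwards [hψd, hψeq.eventually_nhds, hψD, hQ, hQ0] with p h1 h2 h3 h4 h5
  have hΦp := hΦ.differentiableAt (hDo.mem_nhds h3)
  have hcomp : DifferentiableAt ℂ (fun p : ℂ × ℂ => (p.1, ψ p)) p := by fun_prop
  have hder : ∀ e : ℂ × ℂ, pz Φ (p.1, ψ p) * e.1 + pw Φ (p.1, ψ p) * fderiv ℂ ψ p e = e.2 := by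
    intro e
    have k1 := hΦp.hasFDerivAt.comp p (hasFDerivAt_fst.prodMk h1.hasFDerivAt)
    have k2 := (hasFDerivAt_snd (𝕜 := ℂ) (p := p)).congr_of_eventuallyEq h2
    have k3 := congrArg (fun L => L e) (k1.unique k2)
    simp only [ContinuousLinearMap.comp_apply, ContinuousLinearMap.prod_apply,
      ContinuousLinearMap.coe_fst', ContinuousLinearMap.coe_snd'] at k3
    rw [← k3]
    have : (e.1, fderiv ℂ ψ p e) = e.1 • ((1, 0) : ℂ × ℂ) + fderiv ℂ ψ p e • ((0, 1) : ℂ × ℂ) := by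
      simp
    rw [this, map_add, map_smul, map_smul, pz, pw, smul_eq_mul, smul_eq_mul]
    ring
  have hz := hder (1, 0)
  have hw := hder (0, 1)
  have hΦzp : pz Φ (p.1, ψ p) = g p := by
    have k1 : HasFDerivAt (fun z => Φ (z, ψ p))
        (fderiv ℂ Φ (p.1, ψ p) ∘L .inl ℂ ℂ ℂ) p.1 :=
      HasFDerivAt.comp (f := fun z => (z, ψ p)) p.1 hΦp.hasFDerivAt (hasFDerivAt_prodMk_left _ _)
    have := k1.hasDerivAt.unique (hΦz _ h3)
    simpa [h2.self_of_nhds, pz] using this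
  simp only [mul_zero, mul_one, zero_add] at hz hw
  refine ⟨h1, h4.mul ?_, mul_ne_zero h5 (left_ne_zero_of_mul_eq_one hw), ?_, ?_⟩
  · exact DifferentiableAt.comp (f := fun p : ℂ × ℂ => (p.1, ψ p)) p
      ((differentiableOn_fderiv_apply hDo hΦ (0, 1)).differentiableAt (hDo.mem_nhds h3)) hcomp
  · rw [hΦzp] at hz
    change P p = Q p * pw Φ (p.1, ψ p) * fderiv ℂ ψ p (1, 0)
    have : pw Φ (p.1, ψ p) * fderiv ℂ ψ p (1, 0) = - g p := by linear_combination hz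
    rw [mul_assoc, this, hgdef]
    field_simp
  · change Q p = Q p * pw Φ (p.1, ψ p) * fderiv ℂ ψ p (0, 1)
    rw [mul_assoc, hw, mul_one]

theorem pz_comp_swap {f : ℂ × ℂ → ℂ} {p : ℂ × ℂ} (hf : DifferentiableAt ℂ f p.swap) :
    pz (f ∘ Prod.swap) p = pw f p.swap := by
  have := hf.hasFDerivAt.comp p (ContinuousLinearEquiv.prodComm ℂ ℂ ℂ).hasFDerivAt
  exact congrArg (fun L : ℂ × ℂ →L[ℂ] ℂ => L (1, 0)) this.fderiv

theorem pw_comp_swap {f : ℂ × ℂ → ℂ} {p : ℂ × ℂ} (hf : DifferentiableAt ℂ f p.swap) :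
    pw (f ∘ Prod.swap) p = pz f p.swap := by
  have := hf.hasFDerivAt.comp p (ContinuousLinearEquiv.prodComm ℂ ℂ ℂ).hasFDerivAt
  exact congrArg (fun L : ℂ × ℂ →L[ℂ] ℂ => L (0, 1)) this.fderiv

/-- A holomorphic 1-form in two variables is, near a point where it does not vanish, a nonvanishing
multiple of an exact form. -/
theorem exists_integrating_factor {P Q : ℂ × ℂ → ℂ} {x : ℂ × ℂ}
    (hP : ∀ᶠ p in 𝓝 x, DifferentiableAt ℂ P p) (hQ : ∀ᶠ p in 𝓝 x, DifferentiableAt ℂ Q p)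
    (hx : P x ≠ 0 ∨ Q x ≠ 0) :
    ∃ u f : ℂ × ℂ → ℂ, ∀ᶠ p in 𝓝 x, DifferentiableAt ℂ u p ∧ DifferentiableAt ℂ f p ∧
      f p ≠ 0 ∧ P p = f p * pz u p ∧ Q p = f p * pw u p := by
  rcases hx with hx | hx
  · have hd : ∀ {F : ℂ × ℂ → ℂ} {p : ℂ × ℂ}, DifferentiableAt ℂ F p.swap →
        DifferentiableAt ℂ (F ∘ Prod.swap) p := fun {F p} h =>
      h.comp p (ContinuousLinearEquiv.prodComm ℂ ℂ ℂ).differentiableAt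
    have hswap : Tendsto Prod.swap (𝓝 x.swap) (𝓝 x) := by
      simpa using (continuous_swap (X := ℂ) (Y := ℂ)).tendsto x.swap
    obtain ⟨u, f, h⟩ := exists_integrating_factor_of_snd_ne_zero (x := x.swap)
      (P := Q ∘ Prod.swap) (Q := P ∘ Prod.swap)
      ((hswap.eventually hQ).mono fun p => hd) ((hswap.eventually hP).mono fun p => hd)
      (by simpa using hx)
    refine ⟨u ∘ Prod.swap, f ∘ Prod.swap, ?_⟩
    filter_upwards [((continuous_swap (X := ℂ) (Y := ℂ)).tendsto x).eventually h] with p hp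
    obtain ⟨h1, h2, h3, h4, h5⟩ := hp
    refine ⟨hd h1, hd h2, h3, ?_, ?_⟩
    · rw [pz_comp_swap h1]; simpa using h5
    · rw [pw_comp_swap h1]; simpa using h4
  · exact exists_integrating_factor_of_snd_ne_zero hP hQ hx

section

variable {K : Type*} [Field K]

theorem exists_linear_mul_eq_quadratic {q0 q1 q2 : K} {r : K × K} (hr : r ≠ 0)
    (h : q0 * r.1 ^ 2 + q1 * r.1 * r.2 + q2 * r.2 ^ 2 = 0) :
    ∃ l0 l1, q0 = r.2 * l0 ∧ q1 = r.2 * l1 - r.1 * l0 ∧ q2 = -r.1 * l1 := by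
  obtain ⟨a, b⟩ := r
  dsimp only at h ⊢
  by_cases hb : b = 0
  · have ha : a ≠ 0 := by rintro rfl; exact hr (by rw [hb]; rfl)
    subst hb
    refine ⟨-q1 / a, -q2 / a, ?_, ?_, ?_⟩ <;> field_simp <;> simp_all
  · refine ⟨q0 / b, (q1 + a * (q0 / b)) / b, ?_, ?_, ?_⟩
    · field_simp
    · field_simp; ring
    · field_simp; linear_combination h

theorem exists_quadratic_mul_eq_cubic {c0 c1 c2 c3 : K} {r : K × K} (hr : r ≠ 0)
    (h : c0 * r.1 ^ 3 + c1 * r.1 ^ 2 * r.2 + c2 * r.1 * r.2 ^ 2 + c3 * r.2 ^ 3 = 0) :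
    ∃ q0 q1 q2, c0 = r.2 * q0 ∧ c1 = r.2 * q1 - r.1 * q0 ∧ c2 = r.2 * q2 - r.1 * q1 ∧
      c3 = -r.1 * q2 := by
  obtain ⟨a, b⟩ := r
  dsimp only at h ⊢
  by_cases hb : b = 0
  · have ha : a ≠ 0 := by rintro rfl; exact hr (by rw [hb]; rfl)
    subst hb
    refine ⟨-c1 / a, -c2 / a, -c3 / a, ?_, ?_, ?_, ?_⟩ <;> field_simp <;> simp_all
  · refine ⟨c0 / b, (c1 + a * (c0 / b)) / b, (c2 + a * ((c1 + a * (c0 / b)) / b)) / b,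
      ?_, ?_, ?_, ?_⟩
    · field_simp
    · field_simp; ring
    · field_simp; ring
    · field_simp; linear_combination h

/-- A binary cubic with three pairwise non-proportional roots is a product of linear forms. -/
theorem exists_smul_prod_eq_cubic {c0 c1 c2 c3 : K} {r : Fin 3 → K × K}
    (hr : ∀ i j, i ≠ j → (r i).1 * (r j).2 - (r i).2 * (r j).1 ≠ 0)
    (h : ∀ i, c0 * (r i).1 ^ 3 + c1 * (r i).1 ^ 2 * (r i).2 + c2 * (r i).1 * (r i).2 ^ 2 +
      c3 * (r i).2 ^ 3 = 0) :
    ∃ k, c0 = k * ((r 0).2 * (r 1).2 * (r 2).2) ∧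
      c1 = -k * ((r 0).2 * (r 1).2 * (r 2).1 + (r 0).2 * (r 1).1 * (r 2).2 +
        (r 0).1 * (r 1).2 * (r 2).2) ∧
      c2 = k * ((r 0).2 * (r 1).1 * (r 2).1 + (r 0).1 * (r 1).2 * (r 2).1 +
        (r 0).1 * (r 1).1 * (r 2).2) ∧
      c3 = -k * ((r 0).1 * (r 1).1 * (r 2).1) := by
  have h01 := hr 1 0 (by decide)
  have h02 := hr 2 0 (by decide)
  have h12 := hr 2 1 (by decide)
  have h0 := h 0
  have h1 := h 1
  have h2 := h 2
  have hne : ∀ i j, i ≠ j → r i ≠ 0 := fun i j hij h0 => hr i j hij (by simp [h0])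
  obtain ⟨q0, q1, q2, rfl, rfl, rfl, rfl⟩ :=
    exists_quadratic_mul_eq_cubic (hne 0 1 (by decide)) h0
  obtain ⟨l0, l1, rfl, rfl, rfl⟩ := exists_linear_mul_eq_quadratic (hne 1 0 (by decide))
    (q0 := q0) (q1 := q1) (q2 := q2) (mul_left_cancel₀ h01 (by linear_combination h1))
  have hl : l0 * (r 2).1 + l1 * (r 2).2 = 0 :=
    mul_left_cancel₀ (mul_ne_zero h02 h12) (by linear_combination h2)
  obtain ⟨k, rfl, rfl⟩ : ∃ k, l0 = (r 2).2 * k ∧ l1 = -(r 2).1 * k := by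
    by_cases hb : (r 2).2 = 0
    · have ha : (r 2).1 ≠ 0 := fun ha => hne 2 0 (by decide) (Prod.ext ha hb)
      refine ⟨-l1 / (r 2).1, ?_, by field_simp⟩
      simpa [hb, ha] using hl
    · refine ⟨l0 / (r 2).2, by field_simp, ?_⟩
      field_simp
      linear_combination hl
  exact ⟨k, by ring, by ring, by ring, by ring⟩

end

/-- A root of a binary cubic, simple in the direction `e`, depends holomorphically on the
coefficients. -/
theorem exists_cubic_root_near {c0 c1 c2 c3 : ℂ × ℂ → ℂ} {x : ℂ × ℂ}
    (h0 : ∀ᶠ p in 𝓝 x, DifferentiableAt ℂ c0 p) (h1 : ∀ᶠ p in 𝓝 x, DifferentiableAt ℂ c1 p)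
    (h2 : ∀ᶠ p in 𝓝 x, DifferentiableAt ℂ c2 p) (h3 : ∀ᶠ p in 𝓝 x, DifferentiableAt ℂ c3 p)
    {r e : ℂ × ℂ}
    (hr : c0 x * r.1 ^ 3 + c1 x * r.1 ^ 2 * r.2 + c2 x * r.1 * r.2 ^ 2 + c3 x * r.2 ^ 3 = 0)
    (he : (3 * c0 x * r.1 ^ 2 + 2 * c1 x * r.1 * r.2 + c2 x * r.2 ^ 2) * e.1 +
      (c1 x * r.1 ^ 2 + 2 * c2 x * r.1 * r.2 + 3 * c3 x * r.2 ^ 2) * e.2 ≠ 0) :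
    ∃ s t : ℂ × ℂ → ℂ, s x = r.1 ∧ t x = r.2 ∧ ∀ᶠ p in 𝓝 x,
      DifferentiableAt ℂ s p ∧ DifferentiableAt ℂ t p ∧
      c0 p * s p ^ 3 + c1 p * s p ^ 2 * t p + c2 p * s p * t p ^ 2 + c3 p * t p ^ 3 = 0 := by
  set C : ℂ × ℂ → ℂ × ℂ × ℂ × ℂ := fun p => (c0 p, c1 p, c2 p, c3 p) with hC
  have hCd : ∀ᶠ p in 𝓝 x, DifferentiableAt ℂ C p := by
    filter_upwards [h0, h1, h2, h3] with p k0 k1 k2 k3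
    exact k0.prodMk (k1.prodMk (k2.prodMk k3))
  set G : (ℂ × ℂ × ℂ × ℂ) × ℂ → ℂ := fun a =>
    a.1.1 * (r.1 + a.2 * e.1) ^ 3 + a.1.2.1 * (r.1 + a.2 * e.1) ^ 2 * (r.2 + a.2 * e.2) +
      a.1.2.2.1 * (r.1 + a.2 * e.1) * (r.2 + a.2 * e.2) ^ 2 +
      a.1.2.2.2 * (r.2 + a.2 * e.2) ^ 3 with hG
  have hGc : ContDiffAt ℂ 1 G (C x, 0) := by fun_prop
  have hGinv : (fderiv ℂ G (C x, 0) ∘L .inr ℂ (ℂ × ℂ × ℂ × ℂ) ℂ).IsInvertible := by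
    have k1 : HasFDerivAt (fun y : ℂ => G (C x, y))
        (fderiv ℂ G (C x, 0) ∘L .inr ℂ (ℂ × ℂ × ℂ × ℂ) ℂ) 0 :=
      (hGc.differentiableAt one_ne_zero).hasFDerivAt.comp 0 (hasFDerivAt_prodMk_right _ _)
    have hs : HasDerivAt (fun y : ℂ => r.1 + y * e.1) e.1 0 := by
      simpa using ((hasDerivAt_id (0 : ℂ)).mul_const e.1).const_add r.1
    have ht : HasDerivAt (fun y : ℂ => r.2 + y * e.2) e.2 0 := by
      simpa using ((hasDerivAt_id (0 : ℂ)).mul_const e.2).const_add r.2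
    have k2 : HasDerivAt (fun y : ℂ => G (C x, y))
        ((3 * c0 x * r.1 ^ 2 + 2 * c1 x * r.1 * r.2 + c2 x * r.2 ^ 2) * e.1 +
          (c1 x * r.1 ^ 2 + 2 * c2 x * r.1 * r.2 + 3 * c3 x * r.2 ^ 2) * e.2) 0 := by
      refine (((((hs.fun_pow 3).const_mul (c0 x)).fun_add
        (((hs.fun_pow 2).const_mul (c1 x)).fun_mul ht)).fun_add
        ((hs.const_mul (c2 x)).fun_mul (ht.fun_pow 2))).fun_add
        ((ht.fun_pow 3).const_mul (c3 x))).congr_deriv ?_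
      simp
      ring
    rw [k1.unique k2.hasFDerivAt]
    exact ⟨ContinuousLinearEquiv.unitsEquivAut ℂ (Units.mk0 _ he), by ext; simp⟩
  set y := hGc.implicitFunction one_ne_zero hGinv with hy
  have hy0 : y (C x) = 0 := hGc.implicitFunction_apply_self one_ne_zero hGinv
  have hyd : ∀ᶠ c in 𝓝 (C x), DifferentiableAt ℂ y c :=
    ((hGc.contDiffAt_implicitFunction one_ne_zero hGinv).eventually (by simp)).mono
      fun p hp => hp.differentiableAt one_ne_zero
  have hyeq := hGc.eventually_apply_implicitFunction one_ne_zero hGinv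
  have hCt : Tendsto C (𝓝 x) (𝓝 (C x)) := hCd.self_of_nhds.continuousAt
  refine ⟨fun p => r.1 + y (C p) * e.1, fun p => r.2 + y (C p) * e.2, by simp [hy0], by simp [hy0],
    ?_⟩
  filter_upwards [hCd, hCt.eventually hyd, hCt.eventually hyeq] with p k1 k2 k3
  have k4 : DifferentiableAt ℂ (fun p => y (C p)) p := k2.comp p k1
  refine ⟨by fun_prop, by fun_prop, ?_⟩
  have k5 : G (C x, 0) = 0 := by simpa [hG, hC] using hr
  rw [k5] at k3
  exact k3

theorem eventually_differentiableAt_of_eq_mul {κ c S : ℂ × ℂ → ℂ} {x : ℂ × ℂ}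
    (hc : ∀ᶠ p in 𝓝 x, DifferentiableAt ℂ c p) (hS : ∀ᶠ p in 𝓝 x, DifferentiableAt ℂ S p)
    (h : ∀ᶠ p in 𝓝 x, c p = κ p * S p) (hx : c x ≠ 0) :
    ∀ᶠ p in 𝓝 x, DifferentiableAt ℂ κ p ∧ κ p ≠ 0 := by
  have hne : ∀ᶠ p in 𝓝 x, c p ≠ 0 := hc.self_of_nhds.continuousAt.eventually_ne hx
  filter_upwards [hc, hS, hne, (h.and hne).eventually_nhds] with p h1 h2 h3 h4
  have hSp : S p ≠ 0 := right_ne_zero_of_mul (h4.self_of_nhds.1 ▸ h3)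
  refine ⟨(h1.fun_mul (h2.fun_inv hSp)).congr_of_eventuallyEq ?_,
    left_ne_zero_of_mul (h4.self_of_nhds.1 ▸ h3)⟩
  filter_upwards [h4] with q hq
  have : S q ≠ 0 := right_ne_zero_of_mul (hq.1 ▸ hq.2)
  rw [hq.1, mul_inv_cancel_right₀ this]

/-- A holomorphic family of non-degenerate binary cubics factors locally into linear forms with
holomorphic coefficients. -/
theorem exists_holomorphic_factorization {c0 c1 c2 c3 : ℂ × ℂ → ℂ} {x : ℂ × ℂ}
    (h0 : ∀ᶠ p in 𝓝 x, DifferentiableAt ℂ c0 p) (h1 : ∀ᶠ p in 𝓝 x, DifferentiableAt ℂ c1 p)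
    (h2 : ∀ᶠ p in 𝓝 x, DifferentiableAt ℂ c2 p) (h3 : ∀ᶠ p in 𝓝 x, DifferentiableAt ℂ c3 p)
    (hx : NonDegAt c0 c1 c2 c3 x) :
    ∃ (κ : ℂ × ℂ → ℂ) (ω : Fin 3 → Form1), ∀ᶠ p in 𝓝 x, DifferentiableAt ℂ κ p ∧ κ p ≠ 0 ∧
      (∀ i, DifferentiableAt ℂ (ω i).1 p ∧ DifferentiableAt ℂ (ω i).2 p) ∧
      (∀ i j, i ≠ j → wedge (ω i) (ω j) p ≠ 0) ∧
      c0 p = κ p * symC0 (ω 0) (ω 1) (ω 2) p ∧ c1 p = κ p * symC1 (ω 0) (ω 1) (ω 2) p ∧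
      c2 p = κ p * symC2 (ω 0) (ω 1) (ω 2) p ∧ c3 p = κ p * symC3 (ω 0) (ω 1) (ω 2) p := by
  obtain ⟨hne, r, hr, hroot⟩ := hx
  have hsimple : ∀ i, ∃ e : ℂ × ℂ,
      (3 * c0 x * (r i).1 ^ 2 + 2 * c1 x * (r i).1 * (r i).2 + c2 x * (r i).2 ^ 2) * e.1 +
      (c1 x * (r i).1 ^ 2 + 2 * c2 x * (r i).1 * (r i).2 + 3 * c3 x * (r i).2 ^ 2) * e.2 ≠ 0 := by
    obtain ⟨k, e0, e1, e2, e3⟩ := exists_smul_prod_eq_cubic hr hroot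
    have hk : k ≠ 0 := by
      rintro rfl
      simp_all
    intro i
    rw [e0, e1, e2, e3]
    fin_cases i
    · refine ⟨r 1, ne_of_eq_of_ne ?_ (mul_ne_zero (mul_ne_zero hk (hr 1 0 (by decide)))
        (mul_ne_zero (hr 0 1 (by decide)) (hr 0 2 (by decide))))⟩
      dsimp
      ring
    · refine ⟨r 0, ne_of_eq_of_ne ?_ (mul_ne_zero (mul_ne_zero hk (hr 0 1 (by decide)))
        (mul_ne_zero (hr 1 0 (by decide)) (hr 1 2 (by decide))))⟩
      dsimp
      ring
    · refine ⟨r 0, ne_of_eq_of_ne ?_ (mul_ne_zero (mul_ne_zero hk (hr 0 2 (by decide)))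
        (mul_ne_zero (hr 2 0 (by decide)) (hr 2 1 (by decide))))⟩
      dsimp
      ring
  choose e he using hsimple
  choose s t hs ht hst using fun i => exists_cubic_root_near h0 h1 h2 h3 (hroot i) (he i)
  have hst' := eventually_all.2 hst
  set ω : Fin 3 → Form1 := fun i => (t i, fun p => -s i p) with hω
  have hωd : ∀ᶠ p in 𝓝 x, ∀ i, DifferentiableAt ℂ (ω i).1 p ∧ DifferentiableAt ℂ (ω i).2 p :=
    hst'.mono fun p hp i => ⟨(hp i).2.1, (hp i).1.fun_neg⟩
  have hωw : ∀ᶠ p in 𝓝 x, ∀ i j, i ≠ j → wedge (ω i) (ω j) p ≠ 0 := by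
    refine eventually_all.2 fun i => eventually_all.2 fun j => ?_
    by_cases hij : i = j
    · exact .of_forall fun p h => absurd hij h
    have hd := hωd.self_of_nhds
    have hc : ContinuousAt (wedge (ω i) (ω j)) x :=
      (((hd i).1.fun_mul (hd j).2).fun_sub ((hd i).2.fun_mul (hd j).1)).continuousAt
    refine (hc.eventually_ne ?_).mono fun p hp _ => hp
    refine ne_of_eq_of_ne ?_ (hr i j hij)
    simp only [wedge, hω, hs, ht]
    ring
  have hfac : ∀ᶠ p in 𝓝 x, ∃ k,
      c0 p = k * symC0 (ω 0) (ω 1) (ω 2) p ∧ c1 p = k * symC1 (ω 0) (ω 1) (ω 2) p ∧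
      c2 p = k * symC2 (ω 0) (ω 1) (ω 2) p ∧ c3 p = k * symC3 (ω 0) (ω 1) (ω 2) p := by
    filter_upwards [hst', hωw] with p hp hw
    obtain ⟨k, e0, e1, e2, e3⟩ := exists_smul_prod_eq_cubic (r := fun i => (s i p, t i p))
      (fun i j hij => ne_of_eq_of_ne (by simp only [wedge, hω]; ring) (hw i j hij))
      (fun i => (hp i).2.2)
    refine ⟨k, e0, e1.trans ?_, e2.trans ?_, e3.trans ?_⟩ <;>
      simp only [symC1, symC2, symC3, hω] <;> ring
  replace ⟨κ, hfac⟩ := hfac.choice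
  refine ⟨κ, ω, ?_⟩
  have hκd : ∀ᶠ p in 𝓝 x, DifferentiableAt ℂ κ p ∧ κ p ≠ 0 := by
    rcases hne with hne | hne | hne | hne
    · refine eventually_differentiableAt_of_eq_mul h0 ?_ (hfac.mono fun p hp => hp.1) hne
      filter_upwards [hωd] with p hp
      obtain ⟨⟨_, _⟩, ⟨_, _⟩, _, _⟩ := And.intro (hp 0) (And.intro (hp 1) (hp 2))
      unfold symC0
      fun_prop
    · refine eventually_differentiableAt_of_eq_mul h1 ?_ (hfac.mono fun p hp => hp.2.1) hne
      filter_upwards [hωd] with p hp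
      obtain ⟨⟨_, _⟩, ⟨_, _⟩, _, _⟩ := And.intro (hp 0) (And.intro (hp 1) (hp 2))
      unfold symC1
      fun_prop
    · refine eventually_differentiableAt_of_eq_mul h2 ?_ (hfac.mono fun p hp => hp.2.2.1) hne
      filter_upwards [hωd] with p hp
      obtain ⟨⟨_, _⟩, ⟨_, _⟩, _, _⟩ := And.intro (hp 0) (And.intro (hp 1) (hp 2))
      unfold symC2
      fun_prop
    · refine eventually_differentiableAt_of_eq_mul h3 ?_ (hfac.mono fun p hp => hp.2.2.2) hne
      filter_upwards [hωd] with p hp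
      obtain ⟨⟨_, _⟩, ⟨_, _⟩, _, _⟩ := And.intro (hp 0) (And.intro (hp 1) (hp 2))
      unfold symC3
      fun_prop
  filter_upwards [hκd, hωd, hωw, hfac] with p k1 k2 k3 k4
  exact ⟨k1.1, k1.2, k2, k3, k4⟩

/-- a non-degenerate symmetric 3-differential can locally be put in
the normal form `[a du + b dv]·du·dv` in suitable local coordinates `(u,v)`. -/
theorem stmt_2 (U : Set (ℂ × ℂ)) (hU : IsOpen U)
    (c0 c1 c2 c3 : ℂ × ℂ → ℂ)
    (hc0 : DifferentiableOn ℂ c0 U) (hc1 : DifferentiableOn ℂ c1 U)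
    (hc2 : DifferentiableOn ℂ c2 U) (hc3 : DifferentiableOn ℂ c3 U)
    (hnd : ∀ y ∈ U, NonDegAt c0 c1 c2 c3 y)
    (x : ℂ × ℂ) (hx : x ∈ U) :
    ∃ V : Set (ℂ × ℂ), IsOpen V ∧ x ∈ V ∧ V ⊆ U ∧
      ∃ u v a b : ℂ × ℂ → ℂ,
        DifferentiableOn ℂ u V ∧ DifferentiableOn ℂ v V ∧
        (∀ p ∈ V, pz u p * pw v p - pw u p * pz v p ≠ 0) ∧
        DifferentiableOn ℂ a V ∧ DifferentiableOn ℂ b V ∧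
        (∀ p ∈ V, a p ≠ 0) ∧ (∀ p ∈ V, b p ≠ 0) ∧
        (∀ p ∈ V,
          c0 p = symC0 (addF (fsmul a (dfun u)) (fsmul b (dfun v))) (dfun u) (dfun v) p ∧
          c1 p = symC1 (addF (fsmul a (dfun u)) (fsmul b (dfun v))) (dfun u) (dfun v) p ∧
          c2 p = symC2 (addF (fsmul a (dfun u)) (fsmul b (dfun v))) (dfun u) (dfun v) p ∧
          c3 p = symC3 (addF (fsmul a (dfun u)) (fsmul b (dfun v))) (dfun u) (dfun v) p) := by
  have hev : ∀ {c : ℂ × ℂ → ℂ}, DifferentiableOn ℂ c U → ∀ᶠ p in 𝓝 x, DifferentiableAt ℂ c p :=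
    fun {c} hc => (hU.eventually_mem hx).mono fun p hp => hc.differentiableAt (hU.mem_nhds hp)
  obtain ⟨κ, ω, hω⟩ :=
    exists_holomorphic_factorization (hev hc0) (hev hc1) (hev hc2) (hev hc3) (hnd x hx)
  have hform : ∀ i, ∃ u f : ℂ × ℂ → ℂ, ∀ᶠ p in 𝓝 x, DifferentiableAt ℂ u p ∧
      DifferentiableAt ℂ f p ∧ f p ≠ 0 ∧ (ω i).1 p = f p * pz u p ∧ (ω i).2 p = f p * pw u p := by
    intro i
    refine exists_integrating_factor (hω.mono fun p hp => (hp.2.2.1 i).1)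
      (hω.mono fun p hp => (hp.2.2.1 i).2) ?_
    by_contra! h
    obtain ⟨j, hj⟩ := exists_ne i
    exact hω.self_of_nhds.2.2.2.1 i j hj.symm (by simp [wedge, h])
  obtain ⟨u, f, huf⟩ := hform 1
  obtain ⟨v, g, hvg⟩ := hform 2
  set α : ℂ × ℂ → ℂ := fun p => wedge (ω 0) (ω 2) p * (wedge (ω 1) (ω 2) p)⁻¹ with hα
  set β : ℂ × ℂ → ℂ := fun p => wedge (ω 1) (ω 0) p * (wedge (ω 1) (ω 2) p)⁻¹ with hβ
  obtain ⟨V, hV, hVo, hxV⟩ := eventually_nhds_iff.1 (hω.and (huf.and hvg))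
  have hw : ∀ i j, ∀ p ∈ V, DifferentiableAt ℂ (wedge (ω i) (ω j)) p := fun i j p hp =>
    have hd := (hV p hp).1.2.2.1
    ((hd i).1.fun_mul (hd j).2).fun_sub ((hd i).2.fun_mul (hd j).1)
  have hw12 : ∀ p ∈ V, wedge (ω 1) (ω 2) p ≠ 0 := fun p hp =>
    (hV p hp).1.2.2.2.1 1 2 (by decide)
  have hκd : ∀ p ∈ V, DifferentiableAt ℂ κ p := fun p hp => (hV p hp).1.1
  have hfd : ∀ p ∈ V, DifferentiableAt ℂ f p := fun p hp => (hV p hp).2.1.2.1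
  have hgd : ∀ p ∈ V, DifferentiableAt ℂ g p := fun p hp => (hV p hp).2.2.2.1
  have hαd : ∀ p ∈ V, DifferentiableAt ℂ α p := fun p hp =>
    (hw 0 2 p hp).fun_mul ((hw 1 2 p hp).fun_inv (hw12 p hp))
  have hβd : ∀ p ∈ V, DifferentiableAt ℂ β p := fun p hp =>
    (hw 1 0 p hp).fun_mul ((hw 1 2 p hp).fun_inv (hw12 p hp))
  refine ⟨V ∩ U, hVo.inter hU, ⟨hxV, hx⟩, inter_subset_right, u, v,
    fun p => κ p * f p ^ 2 * g p * α p, fun p => κ p * f p * g p ^ 2 * β p,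
    fun p hp => (hV p hp.1).2.1.1.differentiableWithinAt,
    fun p hp => (hV p hp.1).2.2.1.differentiableWithinAt, fun p hp => ?_, fun p hp => ?_,
    fun p hp => ?_, fun p hp => ?_, fun p hp => ?_, fun p hp => ?_⟩
  · obtain ⟨-, ⟨-, -, hf, hu1, hu2⟩, -, -, hg, hv1, hv2⟩ := hV p hp.1
    intro h
    apply hw12 p hp.1
    rw [wedge, hu1, hu2, hv1, hv2]
    linear_combination f p * g p * h
  · have := hκd p hp.1
    have := hfd p hp.1
    have := hgd p hp.1
    have := hαd p hp.1
    exact DifferentiableAt.differentiableWithinAt (by fun_prop)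
  · have := hκd p hp.1
    have := hfd p hp.1
    have := hgd p hp.1
    have := hβd p hp.1
    exact DifferentiableAt.differentiableWithinAt (by fun_prop)
  · obtain ⟨⟨-, hκ, -, hne, -⟩, ⟨-, -, hf, -⟩, -, -, hg, -⟩ := hV p hp.1
    exact mul_ne_zero (mul_ne_zero (mul_ne_zero hκ (pow_ne_zero 2 hf)) hg)
      (mul_ne_zero (hne 0 2 (by decide)) (inv_ne_zero (hw12 p hp.1)))
  · obtain ⟨⟨-, hκ, -, hne, -⟩, ⟨-, -, hf, -⟩, -, -, hg, -⟩ := hV p hp.1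
    exact mul_ne_zero (mul_ne_zero (mul_ne_zero hκ hf) (pow_ne_zero 2 hg))
      (mul_ne_zero (hne 1 0 (by decide)) (inv_ne_zero (hw12 p hp.1)))
  · obtain ⟨⟨-, -, -, -, e0, e1, e2, e3⟩, ⟨-, -, -, hu1, hu2⟩, -, -, -, hv1, hv2⟩ := hV p hp.1
    have hne := hw12 p hp.1
    have h1 : (ω 0).1 p = α p * (f p * pz u p) + β p * (g p * pz v p) := by
      rw [← hu1, ← hv1]
      simp only [hα, hβ]
      field_simp
      simp only [wedge]
      ring
    have h2 : (ω 0).2 p = α p * (f p * pw u p) + β p * (g p * pw v p) := by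
      rw [← hu2, ← hv2]
      simp only [hα, hβ]
      field_simp
      simp only [wedge]
      ring
    simp only [symC0, symC1, symC2, symC3] at e0 e1 e2 e3
    simp only [symC0, symC1, symC2, symC3, addF, fsmul, dfun, e0, e1, e2, e3, h1, h2, hu1, hu2,
      hv1, hv2]
    refine ⟨?_, ?_, ?_, ?_⟩ <;> ring
end
end

section
/- (Theorem 1) Let U ⊆ ℂ × ℂ be open, x ∈ U, let a, b be nonvanishing holomorphic functions on U, and let η = (0, a, b, 0) be the symmetric 3-differential a dz²dw + b dz dw². With A = ∂_z(a_w/a), B = ∂_w(b_z/b), assume A − B is nonvanishing on U, and define ξ = (1/(A−B))·[ a·∂_z((b/a)·B) − b·∂_w((a/b)·A) ]. Then η is closed at x if and only if the equations ∂_z(ξ/a) = A and ∂_w(ξ/b) = B hold on some open neighborhood of x. -/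
noncomputable section

open Filter Topology Metric Set

/-- Cauchy's formula for a directional derivative on a small circle. -/
lemma fderiv_apply_eq_circleIntegral {E : Type*} [NormedAddCommGroup E] [NormedSpace ℂ E]
    {F : E → ℂ} {p v : E} {R r : ℝ} (hF : DifferentiableOn ℂ F (ball p R)) (hr : 0 < r)
    (hrv : r * ‖v‖ < R) :
    fderiv ℂ F p v =
      (2 * Real.pi * Complex.I : ℂ)⁻¹ • ∮ ζ in C(0, r), ((ζ - 0) ^ 2)⁻¹ • F (p + ζ • v) := by
  set W : Set ℂ := (fun ζ : ℂ => p + ζ • v) ⁻¹' ball p R with hW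
  have hWo : IsOpen W := isOpen_ball.preimage (by fun_prop)
  have hmap : DifferentiableOn ℂ (fun ζ : ℂ => F (p + ζ • v)) W :=
    hF.comp (by fun_prop) (mapsTo_preimage _ _)
  have hsub : closedBall (0 : ℂ) r ⊆ W := by
    intro ζ hζ
    rw [mem_closedBall_zero_iff] at hζ
    simp only [hW, mem_preimage, mem_ball, dist_self_add_left, norm_smul]
    exact (mul_le_mul_of_nonneg_right hζ (norm_nonneg _)).trans_lt hrv
  have hR : 0 < R := (by positivity : 0 ≤ r * ‖v‖).trans_lt hrv
  have h1 : HasFDerivAt F (fderiv ℂ F p) (p + (0 : ℂ) • v) := by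
    simpa using (hF.differentiableAt (ball_mem_nhds p hR)).hasFDerivAt
  have h2 : HasDerivAt (fun ζ : ℂ => p + ζ • v) v 0 := by
    simpa using ((hasDerivAt_id (0 : ℂ)).smul_const v).const_add p
  have h3 := (h1.comp_hasDerivAt (0 : ℂ) h2).deriv
  have h4 := Complex.two_pi_I_inv_smul_circleIntegral_sub_sq_inv_smul_of_differentiable
    hWo hsub hmap (mem_ball_self hr)
  rw [h4, ← h3]
  rfl

/-- Directional derivatives of holomorphic functions of several variables are holomorphic. -/
lemma differentiableOn_fderiv_apply_const {E : Type*} [NormedAddCommGroup E] [NormedSpace ℂ E]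
    [FiniteDimensional ℂ E] {F : E → ℂ} {U : Set E} (hF : DifferentiableOn ℂ F U)
    (hU : IsOpen U) (v : E) : DifferentiableOn ℂ (fun p => fderiv ℂ F p v) U := by
  intro p₀ hp₀
  refine DifferentiableAt.differentiableWithinAt ?_
  have hc : ContinuousAt F p₀ := (hF.differentiableAt (hU.mem_nhds hp₀)).continuousAt
  have hev : ∀ᶠ p in 𝓝 p₀, p ∈ U ∧ dist (F p) (F p₀) < 1 :=
    (hU.eventually_mem hp₀).and (hc.eventually (ball_mem_nhds _ one_pos))
  obtain ⟨R, hR, hball⟩ := Metric.eventually_nhds_iff_ball.1 hev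
  obtain ⟨r, hr, hrv⟩ : ∃ r : ℝ, 0 < r ∧ r * ‖v‖ < R / 4 := by
    refine ⟨R / 4 / (‖v‖ + 1), by positivity, ?_⟩
    rw [div_mul_eq_mul_div, div_lt_iff₀ (by positivity)]
    nlinarith [norm_nonneg v]
  have hbig : DifferentiableOn ℂ F (ball p₀ R) := hF.mono fun p hp => (hball p hp).1
  have hin : ∀ p ∈ ball p₀ (R / 4), ∀ θ : ℝ, p + circleMap 0 r θ • v ∈ ball p₀ (R / 2) := by
    intro p hp θ
    have h1 : dist (p + circleMap 0 r θ • v) p < R / 4 := by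
      simpa [norm_smul, abs_of_pos hr] using hrv
    have := dist_triangle (p + circleMap 0 r θ • v) p p₀
    rw [mem_ball] at hp ⊢
    linarith
  have hbound : ∀ p ∈ ball p₀ (R / 2), ‖fderiv ℂ F p‖ ≤ 2 / (R / 2) := by
    intro p hp
    have hsub : ball p (R / 2) ⊆ ball p₀ R :=
      ball_subset_ball' (by rw [mem_ball] at hp; linarith)
    refine Complex.norm_fderiv_le_div_of_mapsTo_ball (hbig.mono hsub) ?_ (by positivity)
    intro q hq
    have h1 := (hball q (hsub hq)).2
    have h2 := (hball p (hsub (mem_ball_self (by positivity)))).2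
    have := dist_triangle_right (F q) (F p) (F p₀)
    rw [mem_closedBall]
    linarith
  have hdiff : ∀ q ∈ ball p₀ R, DifferentiableAt ℂ F q := fun q hq =>
    hbig.differentiableAt (isOpen_ball.mem_nhds hq)
  have hhalf : ball p₀ (R / 2) ⊆ ball p₀ R := ball_subset_ball (by linarith)
  set k : ℝ → ℂ := fun θ => deriv (circleMap 0 r) θ * ((circleMap 0 r θ - 0) ^ 2)⁻¹ with hk
  have hkc : Continuous k := by
    have h0 : ∀ θ, (circleMap 0 r θ - 0) ^ 2 ≠ 0 := fun θ => by
      simpa using hr.ne'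
    simp only [hk, deriv_circleMap]
    exact ((continuous_circleMap 0 r).mul continuous_const).mul
      ((((continuous_circleMap 0 r).sub continuous_const).pow 2).inv₀ h0)
  have hcont : ∀ p ∈ ball p₀ (R / 4), Continuous fun θ => k θ * F (p + circleMap 0 r θ • v) := by
    intro p hp
    refine hkc.mul (continuous_iff_continuousAt.2 fun θ => ?_)
    exact ContinuousAt.comp (f := fun θ : ℝ => p + circleMap 0 r θ • v)
      (hdiff _ (hhalf (hin p hp θ))).continuousAt
      (continuous_const.add ((continuous_circleMap 0 r).smul continuous_const)).continuousAt
  have key := intervalIntegral.hasFDerivAt_integral_of_dominated_of_fderiv_le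
    (μ := MeasureTheory.volume) (a := 0) (b := 2 * Real.pi)
    (F := fun p θ => k θ * F (p + circleMap 0 r θ • v))
    (F' := fun p θ => k θ • fderiv ℂ F (p + circleMap 0 r θ • v))
    (bound := fun θ => ‖k θ‖ * (2 / (R / 2)))
    (ball_mem_nhds p₀ (by positivity : 0 < R / 4))
    (by
      filter_upwards [ball_mem_nhds p₀ (by positivity : 0 < R / 4)] with p hp
      exact (hcont p hp).aestronglyMeasurable)
    ((hcont p₀ (mem_ball_self (by positivity))).intervalIntegrable _ _)
    (by
      borelize E
      have hm : Measurable fun θ : ℝ => fderiv ℂ F (p₀ + circleMap 0 r θ • v) :=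
        (measurable_fderiv ℂ F).comp
          (continuous_const.add ((continuous_circleMap 0 r).smul continuous_const)).measurable
      exact (hkc.measurable.stronglyMeasurable.smul hm.stronglyMeasurable).aestronglyMeasurable)
    (by
      refine Eventually.of_forall fun θ _ p hp => ?_
      rw [norm_smul]
      exact mul_le_mul_of_nonneg_left (hbound _ (hin p hp θ)) (norm_nonneg _))
    ((hkc.norm.mul continuous_const).intervalIntegrable _ _)
    (by
      refine Eventually.of_forall fun θ _ p hp => ?_
      have h1 := (hdiff _ (hhalf (hin p hp θ))).hasFDerivAt
      exact ((hasFDerivAt_comp_add_right (circleMap 0 r θ • v)).2 h1).const_mul (k θ))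
  refine (key.differentiableAt.const_mul (2 * Real.pi * Complex.I : ℂ)⁻¹).congr_of_eventuallyEq ?_
  filter_upwards [ball_mem_nhds p₀ (by positivity : 0 < R / 4)] with p hp
  have hsub : ball p (R / 4) ⊆ ball p₀ R :=
    ball_subset_ball' (by rw [mem_ball] at hp; linarith)
  rw [fderiv_apply_eq_circleIntegral (hbig.mono hsub) hr hrv, circleIntegral, smul_eq_mul]
  simp only [hk, smul_eq_mul, mul_assoc]

/-- The derivative of `F` in the direction `u`. -/
def dirDeriv (u : ℂ × ℂ) (F : ℂ × ℂ → ℂ) (p : ℂ × ℂ) : ℂ := fderiv ℂ F p u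

lemma pz_eq_dirDeriv : pz = dirDeriv (1, 0) := rfl

lemma pw_eq_dirDeriv : pw = dirDeriv (0, 1) := rfl

section DirDeriv

variable {V : Set (ℂ × ℂ)} {F G : ℂ × ℂ → ℂ} {p : ℂ × ℂ}

lemma differentiableOn_dirDeriv (hF : DifferentiableOn ℂ F V) (hV : IsOpen V) (u : ℂ × ℂ) :
    DifferentiableOn ℂ (dirDeriv u F) V :=
  differentiableOn_fderiv_apply_const hF hV u

lemma dirDeriv_congr (hV : IsOpen V) (h : EqOn F G V) (hp : p ∈ V) (u : ℂ × ℂ) :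
    dirDeriv u F p = dirDeriv u G p := by
  have : F =ᶠ[𝓝 p] G := h.eventuallyEq_of_mem (hV.mem_nhds hp)
  rw [dirDeriv, dirDeriv, this.fderiv_eq]

lemma dirDeriv_add (hF : DifferentiableAt ℂ F p) (hG : DifferentiableAt ℂ G p) (u : ℂ × ℂ) :
    dirDeriv u (fun q => F q + G q) p = dirDeriv u F p + dirDeriv u G p := by
  simp [dirDeriv, fderiv_fun_add hF hG]

lemma dirDeriv_sub (hF : DifferentiableAt ℂ F p) (hG : DifferentiableAt ℂ G p) (u : ℂ × ℂ) :
    dirDeriv u (fun q => F q - G q) p = dirDeriv u F p - dirDeriv u G p := by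
  simp [dirDeriv, fderiv_fun_sub hF hG]

lemma dirDeriv_mul (hF : DifferentiableAt ℂ F p) (hG : DifferentiableAt ℂ G p) (u : ℂ × ℂ) :
    dirDeriv u (fun q => F q * G q) p = F p * dirDeriv u G p + dirDeriv u F p * G p := by
  simp [dirDeriv, fderiv_fun_mul hF hG, mul_comm]

lemma dirDeriv_div (hF : DifferentiableAt ℂ F p) (hG : DifferentiableAt ℂ G p) (h0 : G p ≠ 0)
    (u : ℂ × ℂ) :
    dirDeriv u (fun q => F q / G q) p =
      (dirDeriv u F p * G p - F p * dirDeriv u G p) / G p ^ 2 := by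
  have hd : DifferentiableAt ℂ (fun q => F q / G q) p := by
    simpa only [div_eq_mul_inv] using hF.fun_mul (hG.fun_inv h0)
  have h1 := dirDeriv_mul hd hG u
  have h2 : dirDeriv u (fun q => F q / G q * G q) p = dirDeriv u F p := by
    have : (fun q => F q / G q * G q) =ᶠ[𝓝 p] F := by
      filter_upwards [hG.continuousAt.eventually_ne h0] with q hq
      exact div_mul_cancel₀ _ hq
    rw [dirDeriv, this.fderiv_eq, dirDeriv]
  rw [h2] at h1
  rw [h1]
  field_simp
  ring

lemma dirDeriv_eq_zero_of_eqOn_zero (hV : IsOpen V) (h : ∀ q ∈ V, F q = 0) (hp : p ∈ V)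
    (u : ℂ × ℂ) : dirDeriv u F p = 0 := by
  rw [dirDeriv_congr (G := fun _ => 0) hV h hp u]
  simp [dirDeriv]

lemma dirDeriv_comm (hF : DifferentiableOn ℂ F V) (hV : IsOpen V) (hp : p ∈ V) (u v : ℂ × ℂ) :
    dirDeriv u (dirDeriv v F) p = dirDeriv v (dirDeriv u F) p := by
  have hd : DifferentiableAt ℂ (fderiv ℂ F) p := by
    have h1 : fderiv ℂ F = fun q => dirDeriv (1, 0) F q • ContinuousLinearMap.fst ℂ ℂ ℂ +
        dirDeriv (0, 1) F q • ContinuousLinearMap.snd ℂ ℂ ℂ := by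
      funext q
      ext <;> simp [dirDeriv]
    have hz := (differentiableOn_dirDeriv hF hV (1, 0)).differentiableAt (hV.mem_nhds hp)
    have hw := (differentiableOn_dirDeriv hF hV (0, 1)).differentiableAt (hV.mem_nhds hp)
    rw [h1]
    exact (hz.smul_const _).add (hw.smul_const _)
  have hev : ∀ᶠ q in 𝓝 p, HasFDerivAt F (fderiv ℂ F q) q := by
    filter_upwards [hV.mem_nhds hp] with q hq
    exact (hF.differentiableAt (hV.mem_nhds hq)).hasFDerivAt
  have happ : ∀ s t : ℂ × ℂ, dirDeriv s (dirDeriv t F) p = fderiv ℂ (fderiv ℂ F) p s t := by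
    intro s t
    have h : HasFDerivAt (fun q => fderiv ℂ F q t) _ p :=
      hd.hasFDerivAt.clm_apply (hasFDerivAt_const t p)
    change fderiv ℂ (fun q => fderiv ℂ F q t) p s = _
    rw [h.fderiv]
    simp
  rw [happ, happ]
  exact second_derivative_symmetric_of_eventually hev hd.hasFDerivAt u v

lemma dirDeriv_logDeriv_comm (hF : DifferentiableOn ℂ F V) (hV : IsOpen V) (hp : p ∈ V)
    (h0 : F p ≠ 0) (u v : ℂ × ℂ) :
    dirDeriv u (fun q => dirDeriv v F q / F q) p =
      dirDeriv v (fun q => dirDeriv u F q / F q) p := by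
  have hn := hV.mem_nhds hp
  rw [dirDeriv_div ((differentiableOn_dirDeriv hF hV v).differentiableAt hn) (hF.differentiableAt hn) h0,
    dirDeriv_div ((differentiableOn_dirDeriv hF hV u).differentiableAt hn) (hF.differentiableAt hn) h0,
    dirDeriv_comm hF hV hp u v, mul_comm (dirDeriv v F p) (dirDeriv u F p)]

lemma differentiableOn_div (hF : DifferentiableOn ℂ F V) (hG : DifferentiableOn ℂ G V)
    (h0 : ∀ q ∈ V, G q ≠ 0) : DifferentiableOn ℂ (fun q => F q / G q) V := by
  simpa only [div_eq_mul_inv] using hF.fun_mul (hG.fun_inv h0)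

lemma hasDerivAt_slice_fst {z w : ℂ} (hF : DifferentiableAt ℂ F (z, w)) :
    HasDerivAt (fun ζ => F (ζ, w)) (dirDeriv (1, 0) F (z, w)) z :=
  hF.hasFDerivAt.comp_hasDerivAt (f := fun ζ => (ζ, w)) z
    ((hasDerivAt_id z).prodMk (hasDerivAt_const z w))

lemma hasDerivAt_slice_snd {z w : ℂ} (hF : DifferentiableAt ℂ F (z, w)) :
    HasDerivAt (fun ζ => F (z, ζ)) (dirDeriv (0, 1) F (z, w)) w :=
  hF.hasFDerivAt.comp_hasDerivAt (f := fun ζ => (z, ζ)) w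
    ((hasDerivAt_const w z).prodMk (hasDerivAt_id w))

lemma dirDeriv_of_slice {P : ℂ → ℂ} {P' : ℂ} {L : ℂ × ℂ →L[ℂ] ℂ}
    (hP : HasDerivAt P P' (L p)) (u : ℂ × ℂ) :
    dirDeriv u (fun q => P (L q)) p = P' * L u := by
  have h := hP.comp_hasFDerivAt p L.hasFDerivAt
  rw [dirDeriv]
  change fderiv ℂ (P ∘ L) p u = _
  rw [h.fderiv]
  simp

end DirDeriv

section Xi

variable {V : Set (ℂ × ℂ)} {a b S : ℂ × ℂ → ℂ}

lemma dirDeriv_eq_of_dirDeriv_div_eq {c : ℂ} {p : ℂ × ℂ} (hS : DifferentiableAt ℂ S p)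
    (ha : DifferentiableAt ℂ a p) (ha0 : a p ≠ 0) {u : ℂ × ℂ}
    (h : dirDeriv u (fun q => S q / a q) p = c) :
    dirDeriv u S p = a p * c + S p * (dirDeriv u a p / a p) := by
  rw [dirDeriv_div hS ha ha0] at h
  rw [← h]
  field_simp
  ring

/-- The mixed derivative of a solution `S` of `∂_u (S / a) = A`, computed from
`∂_v (S / b) = B`. -/
lemma dirDeriv_dirDeriv_of_dirDeriv_div_eq {A B : ℂ × ℂ → ℂ} {u v : ℂ × ℂ} (hV : IsOpen V)
    (hS : DifferentiableOn ℂ S V) (ha : DifferentiableOn ℂ a V) (hb : DifferentiableOn ℂ b V)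
    (ha0 : ∀ q ∈ V, a q ≠ 0) (hb0 : ∀ q ∈ V, b q ≠ 0) (hA : DifferentiableOn ℂ A V)
    (h1 : ∀ q ∈ V, dirDeriv u (fun q => S q / a q) q = A q)
    (h2 : ∀ q ∈ V, dirDeriv v (fun q => S q / b q) q = B q) {p : ℂ × ℂ} (hp : p ∈ V) :
    dirDeriv v (dirDeriv u S) p =
      a p * dirDeriv v A p + dirDeriv v a p * A p +
        (S p * dirDeriv v (fun q => dirDeriv u a q / a q) p +
          (b p * B p + S p * (dirDeriv v b p / b p)) * (dirDeriv u a p / a p)) := by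
  have at' : ∀ {F : ℂ × ℂ → ℂ}, DifferentiableOn ℂ F V → DifferentiableAt ℂ F p :=
    fun hF => hF.differentiableAt (hV.mem_nhds hp)
  have hL := at' (differentiableOn_div (differentiableOn_dirDeriv ha hV u) ha ha0)
  rw [dirDeriv_congr hV (fun q hq => dirDeriv_eq_of_dirDeriv_div_eq
      (hS.differentiableAt (hV.mem_nhds hq)) (ha.differentiableAt (hV.mem_nhds hq))
      (ha0 q hq) (h1 q hq)) hp v,
    dirDeriv_add ((at' ha).fun_mul (at' hA)) ((at' hS).fun_mul hL),
    dirDeriv_mul (at' ha) (at' hA), dirDeriv_mul (at' hS) hL,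
    dirDeriv_eq_of_dirDeriv_div_eq (at' hS) (at' hb) (hb0 p hp) (h2 p hp)]

lemma differentiableOn_Afun (hV : IsOpen V) (ha : DifferentiableOn ℂ a V)
    (ha0 : ∀ q ∈ V, a q ≠ 0) : DifferentiableOn ℂ (Afun a) V :=
  differentiableOn_dirDeriv
    (differentiableOn_div (differentiableOn_dirDeriv ha hV (0, 1)) ha ha0) hV (1, 0)

lemma differentiableOn_Bfun (hV : IsOpen V) (hb : DifferentiableOn ℂ b V)
    (hb0 : ∀ q ∈ V, b q ≠ 0) : DifferentiableOn ℂ (Bfun b) V :=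
  differentiableOn_dirDeriv
    (differentiableOn_div (differentiableOn_dirDeriv hb hV (1, 0)) hb hb0) hV (0, 1)

lemma differentiableOn_xifun (hV : IsOpen V) (ha : DifferentiableOn ℂ a V)
    (hb : DifferentiableOn ℂ b V) (ha0 : ∀ q ∈ V, a q ≠ 0) (hb0 : ∀ q ∈ V, b q ≠ 0)
    (hAB : ∀ q ∈ V, Afun a q - Bfun b q ≠ 0) : DifferentiableOn ℂ (xifun a b) V := by
  have hA := differentiableOn_Afun hV ha ha0
  have hB := differentiableOn_Bfun hV hb hb0
  have h1 := differentiableOn_dirDeriv ((differentiableOn_div hb ha ha0).fun_mul hB) hV (1, 0)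
  have h2 := differentiableOn_dirDeriv ((differentiableOn_div ha hb hb0).fun_mul hA) hV (0, 1)
  exact ((hA.fun_sub hB).fun_inv hAB).fun_mul ((ha.fun_mul h1).fun_sub (hb.fun_mul h2))

/-- The compatibility condition of the system `∂_z (S / a) = A`, `∂_w (S / b) = B` determines
`S`. -/
lemma eq_xifun_of_pz_div_eq_of_pw_div_eq (hV : IsOpen V) (ha : DifferentiableOn ℂ a V)
    (hb : DifferentiableOn ℂ b V) (ha0 : ∀ q ∈ V, a q ≠ 0) (hb0 : ∀ q ∈ V, b q ≠ 0)
    (hAB : ∀ q ∈ V, Afun a q - Bfun b q ≠ 0) (hS : DifferentiableOn ℂ S V)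
    (h1 : ∀ q ∈ V, pz (fun q => S q / a q) q = Afun a q)
    (h2 : ∀ q ∈ V, pw (fun q => S q / b q) q = Bfun b q) {p : ℂ × ℂ} (hp : p ∈ V) :
    S p = xifun a b p := by
  have hA := differentiableOn_Afun hV ha ha0
  have hB := differentiableOn_Bfun hV hb hb0
  have at' : ∀ {F : ℂ × ℂ → ℂ}, DifferentiableOn ℂ F V → DifferentiableAt ℂ F p :=
    fun hF => hF.differentiableAt (hV.mem_nhds hp)
  have e1 := dirDeriv_dirDeriv_of_dirDeriv_div_eq hV hS ha hb ha0 hb0 hA h1 h2 hp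
  have e2 := dirDeriv_dirDeriv_of_dirDeriv_div_eq hV hS hb ha hb0 ha0 hB h2 h1 hp
  have hA' : dirDeriv (0, 1) (fun q => dirDeriv (1, 0) a q / a q) p = Afun a p :=
    dirDeriv_logDeriv_comm ha hV hp (ha0 p hp) _ _
  have hB' : dirDeriv (1, 0) (fun q => dirDeriv (0, 1) b q / b q) p = Bfun b p :=
    dirDeriv_logDeriv_comm hb hV hp (hb0 p hp) _ _
  rw [hA'] at e1
  rw [hB'] at e2
  have e := e1.symm.trans ((dirDeriv_comm hS hV hp _ _).trans e2)
  have ha0p := ha0 p hp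
  have hb0p := hb0 p hp
  rw [xifun, eq_inv_mul_iff_mul_eq₀ (hAB p hp), pz_eq_dirDeriv, pw_eq_dirDeriv,
    dirDeriv_mul (at' (differentiableOn_div hb ha ha0)) (at' hB),
    dirDeriv_mul (at' (differentiableOn_div ha hb hb0)) (at' hA),
    dirDeriv_div (at' hb) (at' ha) ha0p, dirDeriv_div (at' ha) (at' hb) hb0p]
  field_simp at e ⊢
  linear_combination e

/-- If `∂_u Q = 0` then the logarithmic derivative of `Q` in any direction is `u`-constant. -/
lemma dirDeriv_logDeriv_eq_zero {Q : ℂ × ℂ → ℂ} {u : ℂ × ℂ} (hV : IsOpen V)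
    (hQ : DifferentiableOn ℂ Q V) (hQ0 : ∀ q ∈ V, Q q ≠ 0) (h : ∀ q ∈ V, dirDeriv u Q q = 0)
    {p : ℂ × ℂ} (hp : p ∈ V) (v : ℂ × ℂ) :
    dirDeriv u (fun q => dirDeriv v Q q / Q q) p = 0 := by
  rw [dirDeriv_logDeriv_comm hQ hV hp (hQ0 p hp)]
  exact dirDeriv_eq_zero_of_eqOn_zero hV (fun q hq => by rw [h q hq, zero_div]) hp v

lemma dirDeriv_logDeriv_mul {F G : ℂ × ℂ → ℂ} {u v : ℂ × ℂ} (hV : IsOpen V)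
    (hF : DifferentiableOn ℂ F V) (hG : DifferentiableOn ℂ G V)
    (hF0 : ∀ q ∈ V, F q ≠ 0) (hG0 : ∀ q ∈ V, G q ≠ 0) {p : ℂ × ℂ} (hp : p ∈ V) :
    dirDeriv u (fun q => dirDeriv v (fun r => F r * G r) q / (F q * G q)) p =
      dirDeriv u (fun q => dirDeriv v F q / F q) p +
        dirDeriv u (fun q => dirDeriv v G q / G q) p := by
  have hn := hV.mem_nhds hp
  rw [← dirDeriv_add
    ((differentiableOn_div (differentiableOn_dirDeriv hF hV v) hF hF0).differentiableAt hn)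
    ((differentiableOn_div (differentiableOn_dirDeriv hG hV v) hG hG0).differentiableAt hn)]
  refine dirDeriv_congr hV (fun q hq => ?_) hp u
  have hF0q := hF0 q hq
  have hG0q := hG0 q hq
  have hnq := hV.mem_nhds hq
  simp only [dirDeriv_mul (hF.differentiableAt hnq) (hG.differentiableAt hnq)]
  field_simp
  ring

/-- Suppose `a dz² dw + b dz dw²` is the product of `g dw`, `f dz` and `P dz + Q dw`, all closed.
Then `ξ = f g P_w = f g Q_z`, and `ξ` satisfies the two equations. -/
lemma xifun_equations_of_factorization {f g P Q : ℂ × ℂ → ℂ} (hV : IsOpen V)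
    (ha : DifferentiableOn ℂ a V) (hb : DifferentiableOn ℂ b V)
    (ha0 : ∀ q ∈ V, a q ≠ 0) (hb0 : ∀ q ∈ V, b q ≠ 0)
    (hAB : ∀ q ∈ V, Afun a q - Bfun b q ≠ 0)
    (hf : DifferentiableOn ℂ f V) (hg : DifferentiableOn ℂ g V)
    (hP : DifferentiableOn ℂ P V) (hQ : DifferentiableOn ℂ Q V)
    (hfw : ∀ q ∈ V, pw f q = 0) (hgz : ∀ q ∈ V, pz g q = 0)
    (hPQ : ∀ q ∈ V, pw P q = pz Q q)
    (haV : ∀ q ∈ V, a q = g q * f q * P q) (hbV : ∀ q ∈ V, b q = f q * g q * Q q) :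
    ∀ p ∈ V, pz (fun q => xifun a b q / a q) p = Afun a p ∧
      pw (fun q => xifun a b q / b q) p = Bfun b p := by
  have hf0 : ∀ q ∈ V, f q ≠ 0 := fun q hq h => ha0 q hq (by simp [haV q hq, h])
  have hg0 : ∀ q ∈ V, g q ≠ 0 := fun q hq h => ha0 q hq (by simp [haV q hq, h])
  have hP0 : ∀ q ∈ V, P q ≠ 0 := fun q hq h => ha0 q hq (by simp [haV q hq, h])
  have hQ0 : ∀ q ∈ V, Q q ≠ 0 := fun q hq h => hb0 q hq (by simp [hbV q hq, h])
  set S : ℂ × ℂ → ℂ := fun q => f q * g q * pw P q with hSdef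
  have hS : DifferentiableOn ℂ S V :=
    (hf.fun_mul hg).fun_mul (differentiableOn_dirDeriv hP hV (0, 1))
  have hlog : ∀ {u v : ℂ × ℂ} {c k l m : ℂ × ℂ → ℂ}, DifferentiableOn ℂ k V →
      DifferentiableOn ℂ l V → DifferentiableOn ℂ m V → (∀ q ∈ V, k q ≠ 0) →
      (∀ q ∈ V, l q ≠ 0) → (∀ q ∈ V, m q ≠ 0) → (∀ q ∈ V, dirDeriv u k q = 0) →
      (∀ q ∈ V, dirDeriv v l q = 0) → (∀ q ∈ V, c q = k q * l q * m q) → ∀ p ∈ V,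
      dirDeriv u (fun q => dirDeriv v m q / m q) p =
        dirDeriv u (fun q => dirDeriv v c q / c q) p := by
    intro u v c k l m hk hl hm hk0 hl0 hm0 hku hlv hc p hp
    have hkl0 : ∀ q ∈ V, k q * l q ≠ 0 := fun q hq => mul_ne_zero (hk0 q hq) (hl0 q hq)
    have hcong : EqOn (fun q => dirDeriv v c q / c q)
        (fun q => dirDeriv v (fun r => k r * l r * m r) q / (k q * l q * m q)) V := by
      intro q hq
      simp only [hc q hq, dirDeriv_congr hV (fun r hr => hc r hr) hq v]
    have hl' : dirDeriv u (fun q => dirDeriv v l q / l q) p = 0 :=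
      dirDeriv_eq_zero_of_eqOn_zero hV (fun q hq => by rw [hlv q hq, zero_div]) hp u
    rw [dirDeriv_congr hV hcong hp, dirDeriv_logDeriv_mul hV (hk.fun_mul hl) hm hkl0 hm0 hp,
      dirDeriv_logDeriv_mul hV hk hl hk0 hl0 hp,
      dirDeriv_logDeriv_eq_zero hV hk hk0 hku hp, hl']
    ring
  have h1 : ∀ q ∈ V, pz (fun q => S q / a q) q = Afun a q := by
    intro p hp
    refine (dirDeriv_congr hV (fun q hq => ?_) hp (1, 0)).trans
      (hlog (u := (1, 0)) (v := (0, 1)) hg hf hP hg0 hf0 hP0 hgz hfw haV p hp)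
    have := hf0 q hq
    have := hg0 q hq
    have := hP0 q hq
    simp only [hSdef, haV q hq, pw_eq_dirDeriv]
    field_simp
  have h2 : ∀ q ∈ V, pw (fun q => S q / b q) q = Bfun b q := by
    intro p hp
    refine (dirDeriv_congr hV (fun q hq => ?_) hp (0, 1)).trans
      (hlog (u := (0, 1)) (v := (1, 0)) hf hg hQ hf0 hg0 hQ0 hfw hgz hbV p hp)
    have := hf0 q hq
    have := hg0 q hq
    have := hQ0 q hq
    simp only [hSdef, hbV q hq, hPQ q hq, pz_eq_dirDeriv]
    field_simp
  have hSxi : EqOn (xifun a b) S V := fun q hq =>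
    (eq_xifun_of_pz_div_eq_of_pw_div_eq hV ha hb ha0 hb0 hAB hS h1 h2 hq).symm
  intro p hp
  rw [← h1 p hp, ← h2 p hp]
  exact ⟨dirDeriv_congr hV (fun q hq => by simp only [hSxi hq]) hp _,
    dirDeriv_congr hV (fun q hq => by simp only [hSxi hq]) hp _⟩

end Xi

section Factorization

variable {U V : Set (ℂ × ℂ)} {a b : ℂ × ℂ → ℂ} {x : ℂ × ℂ}

/-- If `0 dz³ + a dz² dw + b dz dw² + 0 dw³` is a product of three closed forms, of which the
first is proportional to `dw` and the second to `dz` at `x`, then `ξ` satisfies the two equations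
near `x`. -/
lemma xifun_equations_of_symProduct (ha : DifferentiableOn ℂ a U)
    (hb : DifferentiableOn ℂ b U) (ha0 : ∀ p ∈ U, a p ≠ 0) (hb0 : ∀ p ∈ U, b p ≠ 0)
    (hAB : ∀ p ∈ U, Afun a p - Bfun b p ≠ 0) (hV : IsOpen V) (hx : x ∈ V) (hVU : V ⊆ U)
    {z1 z2 z3 : Form1} (h1 : HoloForm z1 V) (h2 : HoloForm z2 V) (h3 : HoloForm z3 V)
    (c1 : IsClosed1 z1 V) (c2 : IsClosed1 z2 V) (c3 : IsClosed1 z3 V)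
    (h : ∀ p ∈ V, 0 = symC0 z1 z2 z3 p ∧ a p = symC1 z1 z2 z3 p ∧
      b p = symC2 z1 z2 z3 p ∧ 0 = symC3 z1 z2 z3 p)
    (hx1 : z1.1 x = 0) (hx2 : z2.2 x = 0) :
    ∃ V : Set (ℂ × ℂ), IsOpen V ∧ x ∈ V ∧ V ⊆ U ∧
      ∀ p ∈ V, pz (fun q => xifun a b q / a q) p = Afun a p ∧
        pw (fun q => xifun a b q / b q) p = Bfun b p := by
  set W : Set (ℂ × ℂ) := V ∩ (fun p => z1.2 p * z2.1 p * (z3.1 p * z3.2 p)) ⁻¹' {0}ᶜ with hW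
  have hWo : IsOpen W := ContinuousOn.isOpen_inter_preimage
    ((h1.2.continuousOn.mul h2.1.continuousOn).mul (h3.1.continuousOn.mul h3.2.continuousOn))
    hV isOpen_compl_singleton
  have hWV : W ⊆ V := inter_subset_left
  have hWU : W ⊆ U := hWV.trans hVU
  have hxW : x ∈ W := by
    obtain ⟨-, e1, e2, -⟩ := h x hx
    have e1' := ha0 x (hVU hx)
    have e2' := hb0 x (hVU hx)
    simp only [e1, e2, symC1, symC2, hx1, hx2] at e1' e2'
    refine ⟨hx, ?_⟩
    simp only [mem_preimage, mem_compl_iff, mem_singleton_iff]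
    intro h0
    rcases mul_eq_zero.1 h0 with h0 | h0
    · exact e1' (by linear_combination z3.1 x * h0)
    · rcases mul_eq_zero.1 h0 with h0 | h0
      · exact e1' (by linear_combination z1.2 x * z2.1 x * h0)
      · exact e2' (by linear_combination z1.2 x * z2.1 x * h0)
  have hz1 : ∀ q ∈ W, z1.1 q = 0 := by
    intro q hq
    have hq0 : ¬ z1.2 q * z2.1 q * (z3.1 q * z3.2 q) = 0 := hq.2
    have e := (h q (hWV hq)).1
    simp only [symC0] at e
    grind
  have hz2 : ∀ q ∈ W, z2.2 q = 0 := by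
    intro q hq
    have hq0 : ¬ z1.2 q * z2.1 q * (z3.1 q * z3.2 q) = 0 := hq.2
    have e := (h q (hWV hq)).2.2.2
    simp only [symC3] at e
    grind
  refine ⟨W, hWo, hxW, hWU, xifun_equations_of_factorization hWo (ha.mono hWU) (hb.mono hWU)
    (fun q hq => ha0 q (hWU hq)) (fun q hq => hb0 q (hWU hq)) (fun q hq => hAB q (hWU hq))
    (h2.1.mono hWV) (h1.2.mono hWV) (h3.1.mono hWV) (h3.2.mono hWV)
    (fun q hq => ?_) (fun q hq => ?_) (fun q hq => c3 q (hWV hq))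
    (fun q hq => ?_) (fun q hq => ?_)⟩
  · exact (c2 q (hWV hq)).trans (dirDeriv_eq_zero_of_eqOn_zero hWo hz2 hq _)
  · exact (c1 q (hWV hq)).symm.trans (dirDeriv_eq_zero_of_eqOn_zero hWo hz1 hq _)
  · rw [(h q (hWV hq)).2.1, symC1, hz1 q hq, hz2 q hq]
    ring
  · rw [(h q (hWV hq)).2.2.1, symC2, hz1 q hq, hz2 q hq]
    ring

lemma symProduct_swap_left {c0 c1 c2 c3 : ℂ} {z1 z2 z3 : Form1} {p : ℂ × ℂ}
    (h : c0 = symC0 z1 z2 z3 p ∧ c1 = symC1 z1 z2 z3 p ∧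
      c2 = symC2 z1 z2 z3 p ∧ c3 = symC3 z1 z2 z3 p) :
    c0 = symC0 z2 z1 z3 p ∧ c1 = symC1 z2 z1 z3 p ∧
      c2 = symC2 z2 z1 z3 p ∧ c3 = symC3 z2 z1 z3 p := by
  simp only [symC0, symC1, symC2, symC3] at h ⊢
  grind

lemma symProduct_rotate {c0 c1 c2 c3 : ℂ} {z1 z2 z3 : Form1} {p : ℂ × ℂ}
    (h : c0 = symC0 z1 z2 z3 p ∧ c1 = symC1 z1 z2 z3 p ∧
      c2 = symC2 z1 z2 z3 p ∧ c3 = symC3 z1 z2 z3 p) :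
    c0 = symC0 z2 z3 z1 p ∧ c1 = symC1 z2 z3 z1 p ∧
      c2 = symC2 z2 z3 z1 p ∧ c3 = symC3 z2 z3 z1 p := by
  simp only [symC0, symC1, symC2, symC3] at h ⊢
  grind

lemma xifun_equations_of_closedAt (ha : DifferentiableOn ℂ a U)
    (hb : DifferentiableOn ℂ b U) (ha0 : ∀ p ∈ U, a p ≠ 0) (hb0 : ∀ p ∈ U, b p ≠ 0)
    (hAB : ∀ p ∈ U, Afun a p - Bfun b p ≠ 0)
    (h : ClosedAt U (fun _ => 0) a b (fun _ => 0) x) :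
    ∃ V : Set (ℂ × ℂ), IsOpen V ∧ x ∈ V ∧ V ⊆ U ∧
      ∀ p ∈ V, pz (fun q => xifun a b q / a q) p = Afun a p ∧
        pw (fun q => xifun a b q / b q) p = Bfun b p := by
  obtain ⟨V, hV, hx, hVU, z1, z2, z3, h1, h2, h3, c1, c2, c3, h⟩ := h
  obtain ⟨e0, e1, -, e3⟩ := h x hx
  have e1' := ha0 x (hVU hx)
  simp only [symC0, symC1, symC3] at e0 e1 e3
  have hij : (z1.1 x = 0 ∧ z2.2 x = 0) ∨ (z1.1 x = 0 ∧ z3.2 x = 0) ∨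
      (z2.1 x = 0 ∧ z1.2 x = 0) ∨ (z2.1 x = 0 ∧ z3.2 x = 0) ∨
      (z3.1 x = 0 ∧ z1.2 x = 0) ∨ (z3.1 x = 0 ∧ z2.2 x = 0) := by
    grind
  rcases hij with ⟨i, j⟩ | ⟨i, j⟩ | ⟨i, j⟩ | ⟨i, j⟩ | ⟨i, j⟩ | ⟨i, j⟩
  · exact xifun_equations_of_symProduct ha hb ha0 hb0 hAB hV hx hVU h1 h2 h3 c1 c2 c3 h i j
  · exact xifun_equations_of_symProduct ha hb ha0 hb0 hAB hV hx hVU h1 h3 h2 c1 c3 c2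
      (fun p hp => symProduct_swap_left (symProduct_rotate (symProduct_rotate (h p hp)))) i j
  · exact xifun_equations_of_symProduct ha hb ha0 hb0 hAB hV hx hVU h2 h1 h3 c2 c1 c3
      (fun p hp => symProduct_swap_left (h p hp)) i j
  · exact xifun_equations_of_symProduct ha hb ha0 hb0 hAB hV hx hVU h2 h3 h1 c2 c3 c1
      (fun p hp => symProduct_rotate (h p hp)) i j
  · exact xifun_equations_of_symProduct ha hb ha0 hb0 hAB hV hx hVU h3 h1 h2 c3 c1 c2
      (fun p hp => symProduct_rotate (symProduct_rotate (h p hp))) i j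
  · exact xifun_equations_of_symProduct ha hb ha0 hb0 hAB hV hx hVU h3 h2 h1 c3 c2 c1
      (fun p hp => symProduct_swap_left (symProduct_rotate (h p hp))) i j

/-- A function with `∂_w F = 0` on a polydisc has a `z`-primitive depending only on `z`. -/
lemma exists_primitive_fst {F : ℂ × ℂ → ℂ} {c : ℂ × ℂ} {r : ℝ}
    (hF : DifferentiableOn ℂ F (ball c r)) (h : ∀ q ∈ ball c r, pw F q = 0) :
    ∃ P : ℂ → ℂ, ∀ q ∈ ball c r, HasDerivAt P (F q) q.1 := by
  have hat : ∀ q ∈ ball c.1 r ×ˢ ball c.2 r, DifferentiableAt ℂ F q := by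
    intro q hq
    rw [ball_prod_same] at hq
    exact hF.differentiableAt (isOpen_ball.mem_nhds hq)
  by_cases hr : 0 < r
  · obtain ⟨P, hP⟩ := DifferentiableOn.isExactOn_ball (f := fun z => F (z, c.2)) (c := c.1)
      (r := r) fun z hz => (hasDerivAt_slice_fst
        (hat (z, c.2) ⟨hz, mem_ball_self hr⟩)).differentiableAt.differentiableWithinAt
    refine ⟨P, fun q hq => ?_⟩
    have hq' : q ∈ ball c.1 r ×ˢ ball c.2 r := by rwa [ball_prod_same]
    have hconst : F (q.1, c.2) = F (q.1, q.2) :=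
      isOpen_ball.is_const_of_deriv_eq_zero (f := fun w => F (q.1, w))
        (convex_ball c.2 r).isPreconnected
        (fun w hw => (hasDerivAt_slice_snd
          (hat (q.1, w) ⟨hq'.1, hw⟩)).differentiableAt.differentiableWithinAt)
        (fun w hw => (hasDerivAt_slice_snd (hat (q.1, w) ⟨hq'.1, hw⟩)).deriv.trans
          (h _ (by rw [← ball_prod_same]; exact ⟨hq'.1, hw⟩)))
        (mem_ball_self hr) hq'.2
    exact hconst ▸ hP q.1 hq'.1
  · exact ⟨0, fun q hq => by simp [ball_eq_empty.2 (not_lt.1 hr)] at hq⟩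

/-- A function with `∂_z F = 0` on a polydisc has a `w`-primitive depending only on `w`. -/
lemma exists_primitive_snd {F : ℂ × ℂ → ℂ} {c : ℂ × ℂ} {r : ℝ}
    (hF : DifferentiableOn ℂ F (ball c r)) (h : ∀ q ∈ ball c r, pz F q = 0) :
    ∃ P : ℂ → ℂ, ∀ q ∈ ball c r, HasDerivAt P (F q) q.2 := by
  have hswap : ∀ q ∈ ball c.swap r, q.swap ∈ ball c r := by
    intro q hq
    simpa [mem_ball, Prod.dist_eq, max_comm] using hq
  have hat : ∀ q ∈ ball c r, DifferentiableAt ℂ F q := fun q hq =>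
    hF.differentiableAt (isOpen_ball.mem_nhds hq)
  obtain ⟨P, hP⟩ := exists_primitive_fst (F := fun q => F q.swap) (c := c.swap) (r := r)
    (hF.comp (differentiable_snd.prodMk differentiable_fst).differentiableOn hswap) (by
      intro q hq
      have hd : DifferentiableAt ℂ (fun q : ℂ × ℂ => F q.swap) q :=
        (hat _ (hswap q hq)).comp q (differentiable_snd.prodMk differentiable_fst).differentiableAt
      exact (hasDerivAt_slice_snd (z := q.1) (w := q.2) hd).unique
        (hasDerivAt_slice_fst (z := q.2) (w := q.1) (hat _ (hswap q hq))) |>.trans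
        (h _ (hswap q hq)))
  refine ⟨P, fun q hq => ?_⟩
  have := hP q.swap (by simpa [mem_ball, Prod.dist_eq, max_comm] using hq)
  simpa using this

lemma closedAt_of_xifun_equations (ha : DifferentiableOn ℂ a U)
    (hb : DifferentiableOn ℂ b U) (ha0 : ∀ p ∈ U, a p ≠ 0) (hb0 : ∀ p ∈ U, b p ≠ 0)
    (hAB : ∀ p ∈ U, Afun a p - Bfun b p ≠ 0)
    (h : ∃ V : Set (ℂ × ℂ), IsOpen V ∧ x ∈ V ∧ V ⊆ U ∧
      ∀ p ∈ V, pz (fun q => xifun a b q / a q) p = Afun a p ∧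
        pw (fun q => xifun a b q / b q) p = Bfun b p) :
    ClosedAt U (fun _ => 0) a b (fun _ => 0) x := by
  obtain ⟨V, hV, hx, hVU, h⟩ := h
  obtain ⟨r, hr, hball⟩ := Metric.isOpen_iff.1 hV x hx
  set W := ball x r with hW
  have hWo : IsOpen W := isOpen_ball
  have hWU : W ⊆ U := hball.trans hVU
  replace ha := ha.mono hWU
  replace hb := hb.mono hWU
  replace ha0 : ∀ q ∈ W, a q ≠ 0 := fun q hq => ha0 q (hWU hq)
  replace hb0 : ∀ q ∈ W, b q ≠ 0 := fun q hq => hb0 q (hWU hq)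
  have hxi := differentiableOn_xifun hWo ha hb ha0 hb0 fun q hq => hAB q (hWU hq)
  have hxa := differentiableOn_div hxi ha ha0
  have hxb := differentiableOn_div hxi hb hb0
  have hla := differentiableOn_div (differentiableOn_dirDeriv ha hWo (0, 1)) ha ha0
  have hlb := differentiableOn_div (differentiableOn_dirDeriv hb hWo (1, 0)) hb hb0
  obtain ⟨Q, hQ⟩ := exists_primitive_snd (hxa.fun_sub hla) fun q hq => by
    have hn := hWo.mem_nhds hq
    rw [pz_eq_dirDeriv, dirDeriv_sub (hxa.differentiableAt hn) (hla.differentiableAt hn)]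
    exact sub_eq_zero.2 (h q (hball hq)).1
  obtain ⟨P, hP⟩ := exists_primitive_fst (hxb.fun_sub hlb) fun q hq => by
    have hn := hWo.mem_nhds hq
    rw [pw_eq_dirDeriv, dirDeriv_sub (hxb.differentiableAt hn) (hlb.differentiableAt hn)]
    exact sub_eq_zero.2 (h q (hball hq)).2
  have hP' : DifferentiableOn ℂ (fun q : ℂ × ℂ => P q.1) W := fun q hq =>
    ((hP q hq).differentiableAt.comp q differentiableAt_fst).differentiableWithinAt
  have hQ' : DifferentiableOn ℂ (fun q : ℂ × ℂ => Q q.2) W := fun q hq =>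
    ((hQ q hq).differentiableAt.comp q differentiableAt_snd).differentiableWithinAt
  have hPe := hP'.cexp
  have hQe := hQ'.cexp
  refine ⟨W, hWo, mem_ball_self hr, hWU,
    (fun q => Complex.exp (-P q.1), fun _ => 0), (fun _ => 0, fun q => Complex.exp (-Q q.2)),
    (fun q => Complex.exp (P q.1) * Complex.exp (Q q.2) * a q,
      fun q => Complex.exp (P q.1) * Complex.exp (Q q.2) * b q),
    ⟨hP'.fun_neg.cexp, differentiableOn_const 0⟩, ⟨differentiableOn_const 0, hQ'.fun_neg.cexp⟩,
    ⟨(hPe.fun_mul hQe).fun_mul ha, (hPe.fun_mul hQe).fun_mul hb⟩, ?_, ?_, ?_, ?_⟩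
  · intro q hq
    have h1 := dirDeriv_of_slice (L := ContinuousLinearMap.fst ℂ ℂ ℂ) (p := q)
      (hP q hq).fun_neg.cexp (0, 1)
    have h2 := dirDeriv_eq_zero_of_eqOn_zero (F := fun _ => 0) hWo (fun _ _ => rfl) hq (1, 0)
    exact (h1.trans (by simp)).trans h2.symm
  · intro q hq
    have h1 := dirDeriv_of_slice (L := ContinuousLinearMap.snd ℂ ℂ ℂ) (p := q)
      (hQ q hq).fun_neg.cexp (1, 0)
    have h2 := dirDeriv_eq_zero_of_eqOn_zero (F := fun _ => 0) hWo (fun _ _ => rfl) hq (0, 1)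
    exact h2.trans (h1.trans (by simp)).symm
  · intro q hq
    have hn := hWo.mem_nhds hq
    have ha0q := ha0 q hq
    have hb0q := hb0 q hq
    have hPu : ∀ u, dirDeriv u (fun q => Complex.exp (P q.1)) q = _ := fun u =>
      dirDeriv_of_slice (L := ContinuousLinearMap.fst ℂ ℂ ℂ) (p := q) (hP q hq).cexp u
    have hQu : ∀ u, dirDeriv u (fun q => Complex.exp (Q q.2)) q = _ := fun u =>
      dirDeriv_of_slice (L := ContinuousLinearMap.snd ℂ ℂ ℂ) (p := q) (hQ q hq).cexp u
    simp only [pw_eq_dirDeriv, pz_eq_dirDeriv]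
    rw [dirDeriv_mul ((hPe.fun_mul hQe).differentiableAt hn) (ha.differentiableAt hn),
      dirDeriv_mul ((hPe.fun_mul hQe).differentiableAt hn) (hb.differentiableAt hn),
      dirDeriv_mul (hPe.differentiableAt hn) (hQe.differentiableAt hn),
      dirDeriv_mul (hPe.differentiableAt hn) (hQe.differentiableAt hn), hPu, hPu, hQu, hQu]
    simp only [ContinuousLinearMap.coe_fst', ContinuousLinearMap.coe_snd']
    field_simp
    ring
  · intro q hq
    have hPx : Complex.exp (-P q.1) * Complex.exp (P q.1) = 1 := by
      rw [← Complex.exp_add, neg_add_cancel, Complex.exp_zero]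
    have hQx : Complex.exp (-Q q.2) * Complex.exp (Q q.2) = 1 := by
      rw [← Complex.exp_add, neg_add_cancel, Complex.exp_zero]
    simp only [symC0, symC1, symC2, symC3]
    refine ⟨by ring, ?_, ?_, by ring⟩
    · linear_combination (-a q) * hPx - a q * Complex.exp (-P q.1) * Complex.exp (P q.1) * hQx
    · linear_combination (-b q) * hPx - b q * Complex.exp (-P q.1) * Complex.exp (P q.1) * hQx

end Factorization

/-- Theorem 1: with `η = a dz²dw + b dz dw²`, `A = ∂_z(a_w/a)`,
`B = ∂_w(b_z/b)`, `A − B` nonvanishing and `ξ` as in the paper, `η` is closed at `x`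
iff `∂_z(ξ/a) = A` and `∂_w(ξ/b) = B` near `x`. -/
theorem stmt_3 (U : Set (ℂ × ℂ)) (hU : IsOpen U) (x : ℂ × ℂ) (hx : x ∈ U)
    (a b : ℂ × ℂ → ℂ)
    (ha : DifferentiableOn ℂ a U) (hb : DifferentiableOn ℂ b U)
    (ha0 : ∀ p ∈ U, a p ≠ 0) (hb0 : ∀ p ∈ U, b p ≠ 0)
    (hAB : ∀ p ∈ U, Afun a p - Bfun b p ≠ 0) :
    ClosedAt U (fun _ => 0) a b (fun _ => 0) x ↔
      ∃ V : Set (ℂ × ℂ), IsOpen V ∧ x ∈ V ∧ V ⊆ U ∧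
        ∀ p ∈ V, pz (fun q => xifun a b q / a q) p = Afun a p ∧
                 pw (fun q => xifun a b q / b q) p = Bfun b p := by
  exact ⟨xifun_equations_of_closedAt ha hb ha0 hb0 hAB,
    closedAt_of_xifun_equations ha hb ha0 hb0 hAB⟩
end
end
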